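/- The rate of approximation by negative continued fraction convergents satisfies (log n / n) · log |x − P_n(x)/Q_n(x)| → −π²/3 in measure; that is, for every ε > 0, the Lebesgue measure of {x ∈ (0,1) irrational : |(log n / n) · log |x − P_n(x)/Q_n(x)| + π²/3| > ε} tends to 0 as n → ∞. -/

import Mathlib

open MeasureTheory Filter Real

/-- The negative continued fraction map `T(y) = -1/y - ⌊-1/y⌋` (with `T 0 = 0`). -/
noncomputable def negT (y : ℝ) : ℝ := Int.fract (-1 / y)

/-- The `n`-th negative continued fraction digit `a'_n(x) = ⌈1 / T^{n-1}(1-x)⌉`. -/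
noncomputable def negDigit (x : ℝ) (n : ℕ) : ℕ := (⌈1 / negT^[n - 1] (1 - x)⌉).toNat

/-- Numerators of negative continued fraction convergents, shifted so that
`negP x (n+1) = P_n` with `P_{-1} = negP x 0 = 1`, `P_0 = negP x 1 = 1`,
`P_n = a'_n P_{n-1} - P_{n-2}`. -/
noncomputable def negP (x : ℝ) : ℕ → ℤ
  | 0 => 1
  | 1 => 1
  | n + 2 => negDigit x (n + 1) * negP x (n + 1) - negP x n

/-- Denominators of negative continued fraction convergents, shifted so that
`negQ x (n+1) = Q_n` with `Q_{-1} = negQ x 0 = 0`, `Q_0 = negQ x 1 = 1`,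
`Q_n = a'_n Q_{n-1} - Q_{n-2}`. -/
noncomputable def negQ (x : ℝ) : ℕ → ℤ
  | 0 => 0
  | 1 => 1
  | n + 2 => negDigit x (n + 1) * negQ x (n + 1) - negQ x n

theorem hasSum_sub_succ_of_antitone {e : ℕ → ℝ} (h : Antitone e) (h0 : Tendsto e atTop (nhds 0)) :
    HasSum (fun j => e j - e (j + 1)) (e 0) := by
  rw [hasSum_iff_tendsto_nat_of_nonneg (fun j => sub_nonneg.2 (h (Nat.le_succ j)))]
  simp_rw [Finset.sum_range_sub']
  simpa using tendsto_const_nhds.sub h0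

/-- The weights of the digit distribution: a probability on `ℕ` for every `v > 0`. -/
noncomputable def digitWeight (v : ℝ) (j : ℕ) : ℝ := v / ((v + j) * (v + j + 1))

theorem digitWeight_nonneg {v : ℝ} (hv : 0 < v) (j : ℕ) : 0 ≤ digitWeight v j := by
  unfold digitWeight; positivity

theorem tendsto_div_add_nat (c v : ℝ) : Tendsto (fun j : ℕ => c / (v + j)) atTop (nhds 0) :=
  tendsto_const_nhds.div_atTop (tendsto_atTop_add_const_left _ _ tendsto_natCast_atTop_atTop)

theorem hasSum_digitWeight {v : ℝ} (hv : 0 < v) : HasSum (digitWeight v) 1 := by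
  have h := hasSum_sub_succ_of_antitone (e := fun j : ℕ => v / (v + j))
    (fun i j hij => by
      have : (i : ℝ) ≤ j := by exact_mod_cast hij
      dsimp only
      gcongr) (tendsto_div_add_nat v v)
  convert h using 1
  · ext j
    unfold digitWeight
    have : v + j ≠ 0 := by positivity
    have : v + j + 1 ≠ 0 := by positivity
    have : v + (j + 1) ≠ 0 := by positivity
    push_cast
    field_simp
    ring
  · simp [hv.ne']

theorem digitWeight_le {v : ℝ} (hv : 0 < v) (j : ℕ) :
    digitWeight v j ≤ (v + 1) / ((j : ℝ) + 1) ^ 2 := by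
  unfold digitWeight
  rw [div_le_div_iff₀ (by positivity) (by positivity)]
  have hj : (0 : ℝ) ≤ j := by positivity
  nlinarith [mul_nonneg hv.le hj, mul_nonneg hj hj, mul_pos hv hv, mul_nonneg (mul_nonneg hv.le hj) hj,
    mul_nonneg (mul_pos hv hv).le hj, pow_pos hv 3]

theorem summable_sqrt_div_sq : Summable (fun j : ℕ => √((j : ℝ) + 1) / ((j : ℝ) + 1) ^ 2) := by
  have h : Summable (fun j : ℕ => ((j : ℝ) ^ (3 / 2 : ℝ))⁻¹) :=
    Real.summable_nat_rpow_inv.2 (by norm_num)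
  have h' := (summable_nat_add_iff 1).2 h
  refine h'.congr fun j => ?_
  have hj : (0 : ℝ) < (j : ℝ) + 1 := by positivity
  push_cast
  rw [Real.sqrt_eq_rpow, ← Real.rpow_natCast, ← Real.rpow_neg hj.le, ← Real.rpow_sub hj]
  norm_num

theorem norm_digitWeight_mul_le {v C : ℝ} (hv : 0 < v) {h : ℕ → ℝ}
    (hh : ∀ j, |h j| ≤ C * √((j : ℝ) + 1)) (j : ℕ) :
    ‖digitWeight v j * h j‖ ≤ (v + 1) * C * (√((j : ℝ) + 1) / ((j : ℝ) + 1) ^ 2) := by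
  rw [norm_mul, Real.norm_of_nonneg (digitWeight_nonneg hv j), Real.norm_eq_abs]
  calc digitWeight v j * |h j| ≤ (v + 1) / ((j : ℝ) + 1) ^ 2 * (C * √((j : ℝ) + 1)) :=
        mul_le_mul (digitWeight_le hv j) (hh j) (abs_nonneg _) (by positivity)
    _ = _ := by ring

theorem summable_digitWeight_mul {v C : ℝ} (hv : 0 < v) {h : ℕ → ℝ}
    (hh : ∀ j, |h j| ≤ C * √((j : ℝ) + 1)) : Summable (fun j => digitWeight v j * h j) :=
  Summable.of_norm_bounded (summable_sqrt_div_sq.mul_left _) (norm_digitWeight_mul_le hv hh)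

theorem one_le_sqrt_nat_add_one (j : ℕ) : 1 ≤ √((j : ℝ) + 1) := by
  rw [Real.one_le_sqrt]; linarith [(Nat.cast_nonneg j : (0 : ℝ) ≤ j)]

theorem summable_digitWeight_mul_of_bdd {v C : ℝ} (hv : 0 < v) {h : ℕ → ℝ}
    (hh : ∀ j, |h j| ≤ C) : Summable (fun j => digitWeight v j * h j) :=
  summable_digitWeight_mul hv (C := C) fun j => (hh j).trans
    (le_mul_of_one_le_right ((abs_nonneg _).trans (hh j)) (one_le_sqrt_nat_add_one j))

theorem abs_tsum_digitWeight_mul_le {v C : ℝ} (hv : 0 < v) {h : ℕ → ℝ}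
    (hh : ∀ j, |h j| ≤ C) : |∑' j, digitWeight v j * h j| ≤ C := by
  have h1 : HasSum (fun j => digitWeight v j * C) C := by
    simpa using (hasSum_digitWeight hv).mul_right C
  rw [← Real.norm_eq_abs]
  refine tsum_of_norm_bounded h1 fun j => ?_
  rw [norm_mul, Real.norm_of_nonneg (digitWeight_nonneg hv j)]
  exact mul_le_mul_of_nonneg_left (hh j) (digitWeight_nonneg hv j)

theorem digitWeight_zero {v : ℝ} (hv : 0 < v) : digitWeight v 0 = 1 / (v + 1) := by
  unfold digitWeight; push_cast; field_simp; simp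

theorem digitWeight_succ {v : ℝ} (hv : 0 < v) (j : ℕ) :
    digitWeight v (j + 1) = v / (v + 1) * digitWeight (1 + v) j := by
  unfold digitWeight; push_cast
  have : v + (j + 1) ≠ 0 := by positivity
  have : 1 + v + j ≠ 0 := by positivity
  have : v + (j + 1) + 1 ≠ 0 := by positivity
  have : 1 + v + j + 1 ≠ 0 := by positivity
  field_simp
  ring

/-- Splitting off the digit `0`. -/
theorem tsum_digitWeight_mul {v : ℝ} (hv : 0 < v) {h : ℕ → ℝ}
    (hs : Summable (fun j => digitWeight v j * h j)) :
    ∑' j, digitWeight v j * h j =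
      1 / (v + 1) * h 0 + v / (v + 1) * ∑' j, digitWeight (1 + v) j * h (j + 1) := by
  rw [hs.tsum_eq_zero_add, digitWeight_zero hv, ← tsum_mul_left]
  congr 2
  ext j
  rw [digitWeight_succ hv]; ring

/-- The averaging operator `A f (v) = ∑ j, v / ((v + j) (v + j + 1)) f (1 / (v + j))`. -/
noncomputable def digitAvg (f : ℝ → ℝ) (v : ℝ) : ℝ := ∑' j : ℕ, digitWeight v j * f (1 / (v + j))

/-- The transition operator of the Gauss chain. -/
noncomputable def gaussOp (f : ℝ → ℝ) (σ : ℝ) : ℝ := digitAvg f (1 + σ)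

theorem digitAvg_eq {f : ℝ → ℝ} {v : ℝ} (hv : 0 < v)
    (hs : Summable (fun j : ℕ => digitWeight v j * f (1 / (v + j)))) :
    digitAvg f v = 1 / (v + 1) * f (1 / v) + v / (v + 1) * digitAvg f (1 + v) := by
  unfold digitAvg
  rw [tsum_digitWeight_mul hv (h := fun j : ℕ => f (1 / (v + j))) hs]
  congr 2
  · simp
  · congr 1; ext j; push_cast; congr 3; ring

theorem one_div_add_nat_mem {v : ℝ} (hv : 1 ≤ v) (j : ℕ) : 1 / (v + j) ∈ Set.Ioc (0 : ℝ) 1 := by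
  have hj : (0 : ℝ) ≤ j := by positivity
  refine ⟨by positivity, ?_⟩
  rw [div_le_one (by positivity)]; linarith

theorem abs_digitAvg_le {f : ℝ → ℝ} {C v : ℝ} (hv : 1 ≤ v)
    (hf : ∀ x ∈ Set.Ioc (0 : ℝ) 1, |f x| ≤ C) : |digitAvg f v| ≤ C :=
  abs_tsum_digitWeight_mul_le (by linarith) fun j => hf _ (one_div_add_nat_mem hv j)

/-- The dependence of the averages `∑ j, p_v(j) F(v + j)` on `v`. -/
theorem abs_tsum_digitWeight_sub_le {v v' C S : ℝ} (hv : 1 ≤ v) (hvv : v ≤ v') {F : ℝ → ℝ}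
    {c : ℕ → ℝ}
    (hF : ∀ j : ℕ, |F (v + j)| ≤ C * √((j : ℝ) + 1)) (hF' : ∀ j : ℕ, |F (v' + j)| ≤ C * √((j : ℝ) + 1))
    (hc : HasSum c S)
    (hle : ∀ j : ℕ, digitWeight v' j * |F (v' + j) - F (v + j)| +
      (v' - v) * ((j + 1) / ((v + j + 1) * (v' + j + 1))) * |F (v + j + 1) - F (v + j)| ≤ c j) :
    |∑' j : ℕ, digitWeight v' j * F (v' + j) - ∑' j : ℕ, digitWeight v j * F (v + j)| ≤ S := by
  have hv0 : 0 < v := by linarith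
  have hv0' : 0 < v' := by linarith
  set D : ℕ → ℝ := fun j => v' / (v' + j) - v / (v + j) with hD
  have hDeq : ∀ j : ℕ, D (j + 1) = (v' - v) * ((j + 1) / ((v + j + 1) * (v' + j + 1))) := fun j => by
    simp only [hD]
    have : v + (j + 1) ≠ 0 := by positivity
    have : v' + (j + 1) ≠ 0 := by positivity
    have : v + j + 1 ≠ 0 := by positivity
    have : v' + j + 1 ≠ 0 := by positivity
    push_cast
    field_simp
    ring
  have hp : ∀ {w : ℝ}, 0 < w → ∀ j : ℕ, digitWeight w j = w / (w + j) - w / (w + (j + 1)) := by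
    intro w hw j
    unfold digitWeight
    have : w + j ≠ 0 := by positivity
    have : w + (j + 1) ≠ 0 := by positivity
    have : w + j + 1 ≠ 0 := by positivity
    field_simp
    ring
  have s1 := summable_digitWeight_mul hv0' hF'
  have s2 := summable_digitWeight_mul hv0 hF
  have s3 := summable_digitWeight_mul hv0' hF
  have hcnn : ∀ j, 0 ≤ c j := fun j => le_trans (by
    have := digitWeight_nonneg hv0' j
    have : 0 ≤ v' - v := by linarith
    positivity) (hle j)
  have s4 : Summable (fun j : ℕ => D (j + 1) * (F (v + j + 1) - F (v + j))) := by
    refine Summable.of_norm_bounded hc.summable fun j => ?_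
    refine le_trans ?_ (hle j)
    rw [norm_mul, Real.norm_eq_abs, Real.norm_eq_abs, hDeq, abs_of_nonneg
      (by have : 0 ≤ v' - v := by linarith
          positivity)]
    have := mul_nonneg (digitWeight_nonneg hv0' j) (abs_nonneg (F (v' + j) - F (v + j)))
    linarith
  have hDF : Tendsto (fun j : ℕ => D j * F (v + j)) atTop (nhds 0) := by
    have h1 : Tendsto (fun j : ℕ => (v' - v) * C * (1 / √((j : ℝ) + 1))) atTop (nhds 0) := by
      have : Tendsto (fun j : ℕ => √((j : ℝ) + 1)) atTop atTop :=
        Real.tendsto_sqrt_atTop.comp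
          (tendsto_atTop_add_const_right _ _ tendsto_natCast_atTop_atTop)
      simpa using ((tendsto_const_nhds (x := (1 : ℝ))).div_atTop this).const_mul ((v' - v) * C)
    refine squeeze_zero_norm (fun j => ?_) h1
    have hj : (0 : ℝ) ≤ j := by positivity
    have hsq : √((j : ℝ) + 1) * √((j : ℝ) + 1) = j + 1 := Real.mul_self_sqrt (by positivity)
    have hDj : |D j| ≤ (v' - v) * (1 / ((j : ℝ) + 1)) := by
      have : D j = (v' - v) * (j / ((v + j) * (v' + j))) := by
        simp only [hD]
        have : v + j ≠ 0 := by positivity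
        have : v' + j ≠ 0 := by positivity
        field_simp
        ring
      rw [this, abs_of_nonneg (mul_nonneg (by linarith) (by positivity))]
      refine mul_le_mul_of_nonneg_left ?_ (by linarith)
      rw [div_le_div_iff₀ (by positivity) (by positivity)]
      nlinarith
    rw [norm_mul, Real.norm_eq_abs, Real.norm_eq_abs]
    calc |D j| * |F (v + j)| ≤ ((v' - v) * (1 / ((j : ℝ) + 1))) * (C * √((j : ℝ) + 1)) :=
          mul_le_mul hDj (hF j) (abs_nonneg _) (mul_nonneg (by linarith) (by positivity))
      _ = _ := by
        have hs : 0 < √((j : ℝ) + 1) := Real.sqrt_pos.2 (by positivity)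
        have : 1 / ((j : ℝ) + 1) * √((j : ℝ) + 1) = 1 / √((j : ℝ) + 1) := by
          rw [div_mul_eq_mul_div, div_eq_div_iff (by positivity) hs.ne']; linarith
        rw [← this]; ring
  have s5 : Summable (fun j : ℕ => digitWeight v' j * F (v + j) - digitWeight v j * F (v + j)) :=
    s3.sub s2
  have hbr : ∑' j : ℕ, (digitWeight v' j * F (v + j) - digitWeight v j * F (v + j)) =
      ∑' j : ℕ, D (j + 1) * (F (v + j + 1) - F (v + j)) := by
    have s6 := s5.sub s4
    have h6 : ∀ j : ℕ, digitWeight v' j * F (v + j) - digitWeight v j * F (v + j) -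
        D (j + 1) * (F (v + j + 1) - F (v + j)) =
        D j * F (v + j) - D (j + 1) * F (v + (j + 1 : ℕ)) := fun j => by
      rw [hp hv0', hp hv0]
      simp only [hD]
      push_cast
      rw [← add_assoc v]
      ring
    have h7 := s6.hasSum.tendsto_sum_nat
    simp_rw [h6] at h7
    have h8 : ∀ n, ∑ i ∈ Finset.range n, (D i * F (v + i) - D (i + 1) * F (v + (i + 1 : ℕ))) =
        D 0 * F (v + (0 : ℕ)) - D n * F (v + n) :=
      fun n => Finset.sum_range_sub' (fun i : ℕ => D i * F (v + i)) n
    simp_rw [h8] at h7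
    have h9 : D 0 = 0 := by simp [hD, hv0.ne', hv0'.ne']
    have h10 : Tendsto (fun n : ℕ => D 0 * F (v + (0 : ℕ)) - D n * F (v + n)) atTop (nhds 0) := by
      rw [h9]; simpa using hDF.neg
    have h11 := tendsto_nhds_unique h7 h10
    simp_rw [← h6] at h11
    rw [s5.tsum_sub s4] at h11
    linarith
  have key : ∑' j : ℕ, digitWeight v' j * F (v' + j) - ∑' j : ℕ, digitWeight v j * F (v + j) =
      ∑' j : ℕ, (digitWeight v' j * (F (v' + j) - F (v + j)) +
        D (j + 1) * (F (v + j + 1) - F (v + j))) := by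
    have s7 : Summable (fun j : ℕ => digitWeight v' j * (F (v' + j) - F (v + j))) := by
      simpa only [mul_sub] using s1.sub s3
    rw [s7.tsum_add s4, ← hbr, s3.tsum_sub s2]
    simp_rw [mul_sub]
    rw [s1.tsum_sub s3]
    ring
  rw [key, ← Real.norm_eq_abs]
  refine tsum_of_norm_bounded hc fun j => ?_
  refine le_trans (norm_add_le _ _) (le_trans (le_of_eq ?_) (hle j))
  rw [norm_mul, norm_mul, Real.norm_of_nonneg (digitWeight_nonneg hv0' j), hDeq,
    Real.norm_of_nonneg (r := (v' - v) * _) (by have : 0 ≤ v' - v := by linarith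
                                                positivity)]
  simp only [Real.norm_eq_abs]

/-- `f` is Lipschitz on `(0, 1]` with constant `K`. -/
def LipIoc (K : ℝ) (f : ℝ → ℝ) : Prop :=
  ∀ x ∈ Set.Ioc (0 : ℝ) 1, ∀ y ∈ Set.Ioc (0 : ℝ) 1, |f x - f y| ≤ K * |x - y|

theorem lipIoc_of_le {K : ℝ} {f : ℝ → ℝ}
    (h : ∀ x y, 0 < x → x ≤ y → y ≤ 1 → |f y - f x| ≤ K * (y - x)) : LipIoc K f := by
  intro x hx y hy
  rcases le_total x y with hxy | hxy
  · rw [abs_sub_comm, abs_sub_comm x, abs_of_nonneg (sub_nonneg.2 hxy)]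
    exact h x y hx.1 hxy hy.2
  · rw [abs_of_nonneg (sub_nonneg.2 hxy)]
    exact h y x hy.1 hxy hx.2

theorem LipIoc.abs_le {K : ℝ} {f : ℝ → ℝ} (h : LipIoc K f) {x : ℝ} (hx : x ∈ Set.Ioc (0 : ℝ) 1) :
    |f x| ≤ |f 1| + |K| := by
  have h1 := h x hx 1 ⟨one_pos, le_rfl⟩
  have h2 : |x - 1| ≤ 1 := _root_.abs_le.2 ⟨by linarith [hx.1], by linarith [hx.2]⟩
  have h3 : K * |x - 1| ≤ |K| :=
    (mul_le_mul_of_nonneg_right (le_abs_self K) (abs_nonneg _)).trans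
      (mul_le_of_le_one_right (abs_nonneg _) h2)
  have h4 := abs_sub_abs_le_abs_sub (f x) (f 1)
  linarith

theorem LipIoc.continuousOn {K : ℝ} {f : ℝ → ℝ} (h : LipIoc K f) :
    ContinuousOn f (Set.Ioc (0 : ℝ) 1) := by
  have : LipschitzOnWith K.toNNReal f (Set.Ioc (0 : ℝ) 1) :=
    LipschitzOnWith.of_dist_le_mul fun x hx y hy => by
      rw [Real.dist_eq, Real.dist_eq]
      exact (h x hx y hy).trans
        (mul_le_mul_of_nonneg_right (Real.le_coe_toNNReal K) (abs_nonneg _))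
  exact this.continuousOn

theorem LipIoc.add {K L : ℝ} {f g : ℝ → ℝ} (hf : LipIoc K f) (hg : LipIoc L g) :
    LipIoc (K + L) (fun x => f x + g x) := by
  intro x hx y hy
  have := abs_add_le (f x - f y) (g x - g y)
  have := hf x hx y hy
  have := hg x hx y hy
  rw [show f x + g x - (f y + g y) = (f x - f y) + (g x - g y) by ring, add_mul]
  linarith

theorem LipIoc.const_mul {K : ℝ} {f : ℝ → ℝ} (hf : LipIoc K f) {c : ℝ} (hc : 0 ≤ c) :
    LipIoc (c * K) (fun x => -(c * f x)) := by
  intro x hx y hy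
  rw [show -(c * f x) - -(c * f y) = -(c * (f x - f y)) by ring, abs_neg, abs_mul, abs_of_nonneg hc,
    mul_assoc]
  exact mul_le_mul_of_nonneg_left (hf x hx y hy) hc

theorem hasSum_inv_sq_sub : HasSum
    (fun j : ℕ => 9 / 10 * (1 / ((j : ℝ) + 1) ^ 2) - 9 / 10 * (1 / (((j + 1 : ℕ) : ℝ) + 1) ^ 2))
    (9 / 10) := by
  have h := hasSum_sub_succ_of_antitone (e := fun j : ℕ => 9 / 10 * (1 / ((j : ℝ) + 1) ^ 2))
    (fun i j hij => by
      have : (i : ℝ) ≤ j := by exact_mod_cast hij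
      dsimp only
      gcongr) (by
      have h1 : Tendsto (fun j : ℕ => 1 / ((j : ℝ) + 1)) atTop (nhds 0) :=
        tendsto_one_div_add_atTop_nhds_zero_nat
      simpa using ((h1.pow 2).const_mul (9 / 10)))
  simpa using h

theorem hasSum_inv_sub (C : ℝ) (hC : 0 ≤ C) : HasSum
    (fun j : ℕ => C * (1 / ((j : ℝ) + 1)) - C * (1 / (((j + 1 : ℕ) : ℝ) + 1))) C := by
  have h := hasSum_sub_succ_of_antitone (e := fun j : ℕ => C * (1 / ((j : ℝ) + 1)))
    (fun i j hij => by
      have : (i : ℝ) ≤ j := by exact_mod_cast hij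
      dsimp only
      gcongr) (by
      have h1 : Tendsto (fun j : ℕ => 1 / ((j : ℝ) + 1)) atTop (nhds 0) :=
        tendsto_one_div_add_atTop_nhds_zero_nat
      simpa using (h1.const_mul C))
  simpa using h

theorem inv_cube_add_inv_cube_le (j : ℕ) :
    1 / (2 * ((j : ℝ) + 1) ^ 3) + 1 / ((j : ℝ) + 2) ^ 3 ≤
      9 / 10 * (1 / ((j : ℝ) + 1) ^ 2) - 9 / 10 * (1 / (((j + 1 : ℕ) : ℝ) + 1) ^ 2) := by
  have hj : (0 : ℝ) ≤ j := by positivity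
  push_cast
  rw [show (j : ℝ) + 1 + 1 = j + 2 by ring]
  have : 9 / 10 * (1 / ((j : ℝ) + 1) ^ 2) - 9 / 10 * (1 / ((j : ℝ) + 2) ^ 2) -
      (1 / (2 * ((j : ℝ) + 1) ^ 3) + 1 / ((j : ℝ) + 2) ^ 3) =
      (9 * ((2 * j + 3) * (j + 1) * (j + 2)) - 5 * (j + 2) ^ 3 - 10 * (j + 1) ^ 3) /
        (10 * ((j : ℝ) + 1) ^ 3 * ((j : ℝ) + 2) ^ 3) := by
    field_simp
    ring
  have h2 : 0 ≤ (9 * ((2 * j + 3) * (j + 1) * (j + 2)) - 5 * (j + 2) ^ 3 - 10 * (j + 1) ^ 3) /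
        (10 * ((j : ℝ) + 1) ^ 3 * ((j : ℝ) + 2) ^ 3) := by
    apply div_nonneg _ (by positivity)
    nlinarith [mul_nonneg hj hj, mul_nonneg (mul_nonneg hj hj) hj]
  linarith

/-- The Gauss chain contracts Lipschitz constants. -/
theorem LipIoc.gaussOp {K : ℝ} {f : ℝ → ℝ} (hf : LipIoc K f) (hK : 0 ≤ K) :
    LipIoc (9 / 10 * K) (gaussOp f) := by
  refine lipIoc_of_le fun x y hx hxy hy => ?_
  have hv : (1 : ℝ) ≤ 1 + x := by linarith
  have hv' : (1 : ℝ) ≤ 1 + y := by linarith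
  have hbd : ∀ {v : ℝ}, 1 ≤ v → ∀ j : ℕ,
      |(fun z => f (1 / z)) (v + j)| ≤ (|f 1| + |K|) * √((j : ℝ) + 1) := fun hv j =>
    (hf.abs_le (one_div_add_nat_mem hv j)).trans
      (le_mul_of_one_le_right (by positivity) (one_le_sqrt_nat_add_one j))
  have hsum := hasSum_inv_sq_sub.mul_left (K * (y - x))
  rw [show K * (y - x) * (9 / 10) = 9 / 10 * K * (y - x) by ring] at hsum
  refine abs_tsum_digitWeight_sub_le (F := fun z => f (1 / z)) hv (by linarith) (hbd hv) (hbd hv')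
    (c := fun j => K * (y - x) *
      (9 / 10 * (1 / ((j : ℝ) + 1) ^ 2) - 9 / 10 * (1 / (((j + 1 : ℕ) : ℝ) + 1) ^ 2)))
    hsum fun j => ?_
  have hj : (0 : ℝ) ≤ j := by positivity
  have hyx : 0 ≤ y - x := by linarith
  have m1 := one_div_add_nat_mem hv j
  have m2 := one_div_add_nat_mem hv' j
  have m3 : 1 / (1 + x + j + 1) ∈ Set.Ioc (0 : ℝ) 1 := by
    have := one_div_add_nat_mem hv (j + 1)
    push_cast at this
    rwa [← add_assoc] at this
  have e1 : |f (1 / (1 + y + j)) - f (1 / (1 + x + j))| ≤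
      K * ((y - x) / ((1 + x + j) * (1 + y + j))) := by
    refine (hf _ m2 _ m1).trans (mul_le_mul_of_nonneg_left (le_of_eq ?_) hK)
    rw [abs_sub_comm, abs_of_nonneg]
    · field_simp; ring
    · rw [sub_nonneg]; gcongr
  have e2 : |f (1 / (1 + x + j + 1)) - f (1 / (1 + x + j))| ≤
      K * (1 / ((1 + x + j) * (1 + x + j + 1))) := by
    refine (hf _ m3 _ m1).trans (mul_le_mul_of_nonneg_left (le_of_eq ?_) hK)
    rw [abs_sub_comm, abs_of_nonneg]
    · field_simp; ring
    · exact sub_nonneg.2 (one_div_le_one_div_of_le (by positivity) (by linarith))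
  have b1 : digitWeight (1 + y) j * (1 / ((1 + x + j) * (1 + y + j))) ≤
      1 / (2 * ((j : ℝ) + 1) ^ 3) := by
    unfold digitWeight
    rw [div_mul_div_comm, mul_one]
    rcases Nat.eq_zero_or_pos j with rfl | hj1
    · norm_num
      rw [div_le_iff₀ (by positivity)]
      have h0 : 0 ≤ y := by linarith
      nlinarith [mul_nonneg h0 h0, mul_nonneg hx.le h0, mul_nonneg (mul_nonneg hx.le h0) h0,
        mul_nonneg (mul_nonneg h0 h0) h0, mul_nonneg hx.le (mul_nonneg (mul_nonneg h0 h0) h0)]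
    · have hj2 : (1 : ℝ) ≤ j := by exact_mod_cast hj1
      have h0 : 0 ≤ y := by linarith
      rw [div_le_div_iff₀ (by positivity) (by positivity), one_mul]
      have a1 : 2 * (1 + y) ≤ 1 + y + j + 1 := by linarith
      have a2 : (j : ℝ) + 1 ≤ 1 + y + j := by linarith
      have a3 : (j : ℝ) + 1 ≤ 1 + x + j := by linarith
      calc (1 + y) * (2 * ((j : ℝ) + 1) ^ 3) =
            (j + 1) * (2 * (1 + y)) * ((j + 1) * (j + 1)) := by ring
        _ ≤ (1 + y + j) * (1 + y + j + 1) * ((1 + x + j) * (1 + y + j)) := by gcongr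
  have b2 : ((j : ℝ) + 1) / ((1 + x + j + 1) * (1 + y + j + 1)) *
      (1 / ((1 + x + j) * (1 + x + j + 1))) ≤ 1 / ((j : ℝ) + 2) ^ 3 := by
    have h0 : 0 ≤ y := by linarith
    rw [div_mul_div_comm, mul_one, div_le_div_iff₀ (by positivity) (by positivity), one_mul]
    calc ((j : ℝ) + 1) * (j + 2) ^ 3 = (j + 2) * (j + 2) * ((j + 1) * (j + 2)) := by ring
      _ ≤ (1 + x + j + 1) * (1 + y + j + 1) * ((1 + x + j) * (1 + x + j + 1)) := by
        have a1 : (j : ℝ) + 2 ≤ 1 + x + j + 1 := by linarith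
        have a2 : (j : ℝ) + 2 ≤ 1 + y + j + 1 := by linarith
        have a3 : (j : ℝ) + 1 ≤ 1 + x + j := by linarith
        exact mul_le_mul (mul_le_mul a1 a2 (by positivity) (by positivity))
          (mul_le_mul a3 a1 (by positivity) (by positivity)) (by positivity) (by positivity)
  have hc := inv_cube_add_inv_cube_le j
  have hKy : 0 ≤ K * (y - x) := mul_nonneg hK hyx
  calc digitWeight (1 + y) j * |f (1 / (1 + y + j)) - f (1 / (1 + x + j))| +
      (1 + y - (1 + x)) * ((j + 1) / ((1 + x + j + 1) * (1 + y + j + 1))) *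
        |f (1 / (1 + x + j + 1)) - f (1 / (1 + x + j))|
      ≤ digitWeight (1 + y) j * (K * ((y - x) / ((1 + x + j) * (1 + y + j)))) +
      (1 + y - (1 + x)) * ((j + 1) / ((1 + x + j + 1) * (1 + y + j + 1))) *
        (K * (1 / ((1 + x + j) * (1 + x + j + 1)))) := by
        have : 0 ≤ 1 + y - (1 + x) := by linarith
        have h0 : 0 ≤ y := by linarith
        refine add_le_add (mul_le_mul_of_nonneg_left e1 (digitWeight_nonneg (by linarith) j))
          (mul_le_mul_of_nonneg_left e2 (by positivity))
    _ = K * (y - x) * (digitWeight (1 + y) j * (1 / ((1 + x + j) * (1 + y + j))) +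
        ((j : ℝ) + 1) / ((1 + x + j + 1) * (1 + y + j + 1)) *
      (1 / ((1 + x + j) * (1 + x + j + 1)))) := by ring
    _ ≤ _ := mul_le_mul_of_nonneg_left (by linarith) hKy

theorem log_le_mul_sqrt {x : ℝ} (hx : 0 < x) : Real.log x ≤ 2 * √x := by
  have h := Real.log_le_sub_one_of_pos (Real.sqrt_pos.2 hx)
  rw [Real.log_sqrt hx.le] at h
  linarith

theorem abs_log_one_add_le {v : ℝ} (hv : 0 ≤ v) (hv2 : v ≤ 2) (j : ℕ) :
    |Real.log (1 + (v + j))| ≤ 4 * √((j : ℝ) + 1) := by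
  have hj : (0 : ℝ) ≤ j := by positivity
  rw [abs_of_nonneg (Real.log_nonneg (by linarith))]
  refine (log_le_mul_sqrt (by positivity)).trans ?_
  have : √(1 + (v + j)) ≤ √(2 ^ 2 * ((j : ℝ) + 1)) := Real.sqrt_le_sqrt (by linarith)
  rw [Real.sqrt_mul (by norm_num), Real.sqrt_sq (by norm_num)] at this
  linarith

theorem log_sub_log_le {a b : ℝ} (ha : 0 < a) (hab : a ≤ b) :
    |Real.log b - Real.log a| ≤ (b - a) / a := by
  rw [abs_of_nonneg (sub_nonneg.2 (Real.log_le_log ha hab)), ← Real.log_div (by linarith) ha.ne']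
  refine (Real.log_le_sub_one_of_pos (div_pos (by linarith) ha)).trans (le_of_eq ?_)
  field_simp

theorem lipIoc_gaussOp_log : LipIoc 8 (gaussOp fun x => Real.log (1 + 1 / x)) := by
  refine lipIoc_of_le fun x y hx hxy hy => ?_
  have h0 : 0 ≤ y := by linarith
  have hyx : 0 ≤ y - x := by linarith
  have h := abs_tsum_digitWeight_sub_le (F := fun z => Real.log (1 + z)) (v := 1 + x) (v' := 1 + y)
    (by linarith) (by linarith) (C := 4)
    (abs_log_one_add_le (by linarith) (by linarith)) (abs_log_one_add_le (by linarith) (by linarith))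
    (hasSum_inv_sub (8 * (y - x)) (by positivity)) fun j => ?_
  · simpa [gaussOp, digitAvg] using h
  have hj : (0 : ℝ) ≤ j := by positivity
  have e1 := log_sub_log_le (a := 1 + (1 + x + j)) (b := 1 + (1 + y + j)) (by positivity)
    (by linarith)
  have e2 := log_sub_log_le (a := 1 + (1 + x + j)) (b := 1 + (1 + x + j + 1)) (by positivity)
    (by linarith)
  have f1 : |Real.log (1 + (1 + y + j)) - Real.log (1 + (1 + x + j))| ≤ y - x := by
    refine e1.trans ?_
    rw [div_le_iff₀ (by positivity)]
    nlinarith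
  have f2 : |Real.log (1 + (1 + x + j + 1)) - Real.log (1 + (1 + x + j))| ≤ 1 / (j + 1) := by
    refine e2.trans ?_
    rw [div_le_div_iff₀ (by positivity) (by positivity)]
    nlinarith
  have f3 : digitWeight (1 + y) j ≤ 3 / ((j : ℝ) + 1) ^ 2 :=
    (digitWeight_le (by linarith) j).trans (by gcongr; linarith)
  have f4 : ((j : ℝ) + 1) / ((1 + x + j + 1) * (1 + y + j + 1)) ≤ 1 / (j + 1) := by
    rw [div_le_div_iff₀ (by positivity) (by positivity)]
    nlinarith [mul_nonneg hx.le h0, mul_nonneg hj h0, mul_nonneg hj hx.le]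
  calc _ ≤ 3 / ((j : ℝ) + 1) ^ 2 * (y - x) + (1 + y - (1 + x)) * (1 / (j + 1)) * (1 / (j + 1)) := by
        have : 0 ≤ 1 + y - (1 + x) := by linarith
        gcongr
    _ = 4 * (y - x) / ((j : ℝ) + 1) ^ 2 := by field_simp; ring
    _ ≤ 8 * (y - x) / ((j + 1) * (j + 2)) := by
        rw [div_le_div_iff₀ (by positivity) (by positivity)]
        have : 0 ≤ (y - x) * (j * (j + 1)) := by positivity
        nlinarith
    _ = _ := by push_cast; field_simp; ring

theorem lipIoc_log_one_add_div : LipIoc 1 (fun x => Real.log (1 + x) / x) := by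
  refine lipIoc_of_le fun x y hx hxy hy => ?_
  have hy0 : 0 < y := by linarith
  have hyx : 0 ≤ y - x := by linarith
  have hx1 : Real.log (1 + x) ≤ x := by
    have := Real.log_le_sub_one_of_pos (show 0 < 1 + x by linarith); linarith
  have hx2 : x / (1 + x) ≤ Real.log (1 + x) := by
    have := Real.one_sub_inv_le_log_of_pos (show 0 < 1 + x by linarith)
    have h2 : 1 - (1 + x)⁻¹ = x / (1 + x) := by field_simp; ring
    linarith
  have hd1 : Real.log (1 + y) - Real.log (1 + x) ≤ (y - x) / (1 + x) := by
    have := (le_abs_self _).trans (log_sub_log_le (a := 1 + x) (b := 1 + y) (by linarith) (by linarith))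
    simpa using this
  have hd2 : (y - x) / (1 + y) ≤ Real.log (1 + y) - Real.log (1 + x) := by
    rw [← Real.log_div (by linarith) (by linarith)]
    refine le_trans (le_of_eq ?_) (Real.one_sub_inv_le_log_of_pos (by positivity))
    field_simp; ring
  have key : Real.log (1 + y) / y - Real.log (1 + x) / x =
      -((y - x) * Real.log (1 + x) - x * (Real.log (1 + y) - Real.log (1 + x))) / (x * y) := by
    field_simp; ring
  have up : (y - x) * Real.log (1 + x) - x * (Real.log (1 + y) - Real.log (1 + x)) ≤
      (y - x) * (x * y) := by
    have a1 := mul_le_mul_of_nonneg_left hx1 hyx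
    have a2 := mul_le_mul_of_nonneg_left hd2 hx.le
    have a3 : (y - x) * x - x * ((y - x) / (1 + y)) = (y - x) * (x * y) / (1 + y) := by
      field_simp; ring
    have a4 : (y - x) * (x * y) / (1 + y) ≤ (y - x) * (x * y) :=
      div_le_self (by positivity) (by linarith)
    linarith
  have lo : 0 ≤ (y - x) * Real.log (1 + x) - x * (Real.log (1 + y) - Real.log (1 + x)) := by
    have a1 := mul_le_mul_of_nonneg_left hx2 hyx
    have a2 := mul_le_mul_of_nonneg_left hd1 hx.le
    have a3 : (y - x) * (x / (1 + x)) = x * ((y - x) / (1 + x)) := by ring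
    linarith
  rw [key, abs_div, abs_neg, abs_of_nonneg lo, abs_of_pos (show 0 < x * y by positivity),
    div_le_iff₀ (by positivity)]
  linarith

theorem lipIoc_one_add : LipIoc 1 (fun x => 1 + x) := by
  intro x _ y _
  rw [show 1 + x - (1 + y) = x - y by ring, one_mul]

theorem iUnion_Ioc_one_add_nat : ⋃ j : ℕ, Set.Ioc (1 + (j : ℝ)) (1 + j + 1) = Set.Ioi 1 := by
  ext z
  simp only [Set.mem_iUnion, Set.mem_Ioc, Set.mem_Ioi]
  constructor
  · rintro ⟨j, h1, -⟩
    have : (0 : ℝ) ≤ j := by positivity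
    linarith
  · intro hz
    rcases le_or_gt z 2 with h2 | h2
    · exact ⟨0, by push_cast; linarith, by push_cast; linarith⟩
    · have h3 := Nat.le_ceil (z - 2)
      have h4 := Nat.ceil_lt_add_one (a := z - 2) (by linarith)
      exact ⟨⌈z - 2⌉₊, by linarith, by linarith⟩

theorem pairwise_disjoint_Ioc_one_add_nat :
    Pairwise (Function.onFun Disjoint fun j : ℕ => Set.Ioc (1 + (j : ℝ)) (1 + j + 1)) := by
  refine (pairwise_disjoint_on _).2 fun i j hij => Set.disjoint_left.2 fun z h1 h2 => ?_
  have : (i : ℝ) + 1 ≤ j := by exact_mod_cast hij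
  linarith [h1.2, h2.1]

/-- Folding an integral over `(1, ∞)` onto `(0, 1]`. -/
theorem integral_Ioc_tsum_add_nat {g : ℝ → ℝ} (hg : IntegrableOn g (Set.Ioi 1)) :
    ∫ σ in Set.Ioc (0 : ℝ) 1, ∑' j : ℕ, g (1 + σ + j) = ∫ z in Set.Ioi 1, g z := by
  have hpiece : ∀ (h : ℝ → ℝ) (j : ℕ), ∫ σ in Set.Ioc (0 : ℝ) 1, h (1 + σ + j) =
      ∫ z in Set.Ioc (1 + (j : ℝ)) (1 + j + 1), h z := fun h j => by
    rw [← intervalIntegral.integral_of_le zero_le_one,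
      ← intervalIntegral.integral_of_le (by linarith)]
    have := intervalIntegral.integral_comp_add_right (a := 0) (b := 1) h (1 + (j : ℝ))
    rw [zero_add, add_comm 1 (1 + (j : ℝ))] at this
    rw [← this]
    congr 1; ext σ; congr 1; ring
  have hU := hg
  rw [← iUnion_Ioc_one_add_nat] at hU
  have h_intble : ∀ j : ℕ, IntegrableOn (fun σ => g (1 + σ + j)) (Set.Ioc 0 1) := fun j => by
    have h1 : IntegrableOn g (Set.Ioc (1 + (j : ℝ)) (1 + j + 1)) :=
      hU.mono_set (Set.subset_iUnion (fun j : ℕ => Set.Ioc (1 + (j : ℝ)) (1 + j + 1)) j)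
    rw [← intervalIntegrable_iff_integrableOn_Ioc_of_le (by linarith)] at h1
    have h2 := h1.comp_add_right (1 + (j : ℝ))
    rw [sub_self, add_sub_cancel_left,
      intervalIntegrable_iff_integrableOn_Ioc_of_le zero_le_one] at h2
    refine h2.congr_fun (fun σ _ => ?_) measurableSet_Ioc
    dsimp only
    congr 1; ring
  have hs1 := hasSum_integral_iUnion (fun _ : ℕ => measurableSet_Ioc)
    pairwise_disjoint_Ioc_one_add_nat hU
  have hs2 := hasSum_integral_iUnion (fun _ : ℕ => measurableSet_Ioc)
    pairwise_disjoint_Ioc_one_add_nat hU.norm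
  have h3 := hasSum_integral_of_summable_integral_norm h_intble
    (hs2.summable.congr fun j => (hpiece (fun z => ‖g z‖) j).symm)
  simp_rw [hpiece g] at h3
  rw [iUnion_Ioc_one_add_nat] at hs1
  exact h3.unique hs1

theorem image_one_div_Ioo : (fun w : ℝ => 1 / w) '' Set.Ioo 0 1 = Set.Ioi 1 := by
  ext z
  constructor
  · rintro ⟨w, hw, rfl⟩
    exact (one_lt_div hw.1).2 hw.2
  · intro hz
    have hz0 : 0 < z := lt_trans one_pos hz
    exact ⟨1 / z, ⟨by positivity, (div_lt_one hz0).2 hz⟩, by simp⟩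

theorem image_one_div_sub_one_Ioo : (fun w : ℝ => 1 / w - 1) '' Set.Ioo 0 1 = Set.Ioi 0 := by
  have : (fun w : ℝ => 1 / w - 1) = (fun z => z - 1) ∘ (fun w : ℝ => 1 / w) := rfl
  rw [this, Set.image_comp, image_one_div_Ioo]
  ext z
  constructor
  · rintro ⟨w, hw, rfl⟩
    exact sub_pos.2 (Set.mem_Ioi.1 hw)
  · intro hz
    exact ⟨z + 1, by simpa using hz, by simp⟩

theorem injOn_one_div_Ioo : Set.InjOn (fun w : ℝ => 1 / w) (Set.Ioo 0 1) := fun x _ y _ hxy => by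
  simpa using hxy

theorem hasDerivWithinAt_one_div {s : Set ℝ} {w : ℝ} (hw : w ≠ 0) :
    HasDerivWithinAt (fun w : ℝ => 1 / w) (-(w ^ 2)⁻¹) s w := by
  simpa using (hasDerivAt_inv hw).hasDerivWithinAt

/-- The mean of `f` for the (unnormalized) Gauss measure. -/
noncomputable def gaussMean (f : ℝ → ℝ) : ℝ := ∫ σ in Set.Ioc (0 : ℝ) 1, f σ / (1 + σ)

theorem gaussMean_gaussOp_eq {f : ℝ → ℝ}
    (hg : IntegrableOn (fun z => f (1 / z) / (z * (z + 1))) (Set.Ioi 1)) :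
    gaussMean (gaussOp f) = ∫ z in Set.Ioi 1, f (1 / z) / (z * (z + 1)) := by
  rw [← integral_Ioc_tsum_add_nat hg]
  refine setIntegral_congr_fun measurableSet_Ioc fun σ hσ => ?_
  have : 0 < σ := hσ.1
  simp only [gaussOp, digitAvg]
  rw [div_eq_mul_inv, ← tsum_mul_right]
  congr 1; ext j
  unfold digitWeight
  field_simp

theorem LipIoc.integrableOn {K : ℝ} {f : ℝ → ℝ} (hf : LipIoc K f) :
    IntegrableOn (fun σ => f σ / (1 + σ)) (Set.Ioc 0 1) := by
  have hc : IntegrableOn (fun _ : ℝ => |f 1| + |K|) (Set.Ioc 0 1) := by simp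
  refine Integrable.mono' hc ?_ ?_
  · refine ContinuousOn.aestronglyMeasurable
      (hf.continuousOn.div (g := fun σ => 1 + σ) (by fun_prop) fun x hx => ?_)
      measurableSet_Ioc
    have : 0 < x := hx.1
    positivity
  · refine (ae_restrict_iff' measurableSet_Ioc).2 (ae_of_all _ fun x hx => ?_)
    have h0 : 0 < x := hx.1
    rw [norm_div, Real.norm_eq_abs, Real.norm_of_nonneg (by linarith)]
    exact (div_le_self (abs_nonneg _) (by linarith)).trans (hf.abs_le hx)

theorem LipIoc.gaussMean_gaussOp {K : ℝ} {f : ℝ → ℝ} (hf : LipIoc K f) :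
    gaussMean (_root_.gaussOp f) = gaussMean f := by
  have hder : ∀ w ∈ Set.Ioo (0 : ℝ) 1, HasDerivWithinAt (fun w : ℝ => 1 / w) (-(w ^ 2)⁻¹)
    (Set.Ioo 0 1) w := fun w hw => hasDerivWithinAt_one_div hw.1.ne'
  have heq : Set.EqOn (fun w => |-(w ^ 2)⁻¹| • (f (1 / (1 / w)) / ((1 / w) * (1 / w + 1))))
      (fun σ => f σ / (1 + σ)) (Set.Ioo 0 1) := fun w hw => by
    have h0 : 0 < w := hw.1
    dsimp only
    rw [abs_neg, abs_of_pos (by positivity), smul_eq_mul, one_div_one_div]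
    field_simp
  have hi := (hf.integrableOn.mono_set Set.Ioo_subset_Ioc_self).congr_fun heq.symm measurableSet_Ioo
  have h1 := (integrableOn_image_iff_integrableOn_abs_deriv_smul measurableSet_Ioo hder
    injOn_one_div_Ioo (fun z => f (1 / z) / (z * (z + 1)))).2 hi
  have h2 := integral_image_eq_integral_abs_deriv_smul measurableSet_Ioo hder
    injOn_one_div_Ioo (fun z => f (1 / z) / (z * (z + 1)))
  rw [image_one_div_Ioo] at h1 h2
  rw [gaussMean_gaussOp_eq h1, h2, setIntegral_congr_fun measurableSet_Ioo heq, gaussMean,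
    integral_Ioc_eq_integral_Ioo]

theorem LipIoc.abs_le_of_gaussMean_eq_zero {K : ℝ} {f : ℝ → ℝ} (hf : LipIoc K f) (hK : 0 ≤ K)
    (h0 : gaussMean f = 0) {x : ℝ} (hx : x ∈ Set.Ioc (0 : ℝ) 1) : |f x| ≤ K := by
  have hd : ∀ y ∈ Set.Ioc (0 : ℝ) 1, |f x - f y| ≤ K := fun y hy => by
    refine (hf x hx y hy).trans (mul_le_of_le_one_right hK ?_)
    exact _root_.abs_le.2 ⟨by linarith [hx.1, hy.2], by linarith [hx.2, hy.1]⟩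
  have key : ∀ d : ℝ, 0 < d → ∀ g : ℝ → ℝ, IntegrableOn (fun σ => g σ / (1 + σ)) (Set.Ioc 0 1) →
      (∀ y ∈ Set.Ioc (0 : ℝ) 1, d ≤ g y) → 0 < ∫ σ in Set.Ioc (0 : ℝ) 1, g σ / (1 + σ) := by
    intro d hd g hg hdg
    have h1 : ∫ σ in Set.Ioc (0 : ℝ) 1, d / 2 ≤ ∫ σ in Set.Ioc (0 : ℝ) 1, g σ / (1 + σ) := by
      refine setIntegral_mono_on (by simp) hg measurableSet_Ioc fun y hy => ?_
      have := hy.1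
      rw [div_le_div_iff₀ (by norm_num) (by linarith)]
      nlinarith [hdg y hy, hy.2]
    simp at h1
    linarith
  rw [_root_.abs_le]
  constructor
  · by_contra! hc
    have := key (-K - f x) (by linarith) (fun y => - f y) (by
      simpa [neg_div] using hf.integrableOn.neg) fun y hy => by
        have := _root_.abs_le.1 (hd y hy); linarith
    simp_rw [neg_div, integral_neg] at this
    have h : ∫ σ in Set.Ioc (0 : ℝ) 1, f σ / (1 + σ) = 0 := h0
    linarith
  · by_contra! hc
    have := key (f x - K) (by linarith) f hf.integrableOn fun y hy => by
        have := _root_.abs_le.1 (hd y hy); linarith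
    have h : ∫ σ in Set.Ioc (0 : ℝ) 1, f σ / (1 + σ) = 0 := h0
    linarith

theorem hasDerivAt_pow_mul_log (k : ℕ) {w : ℝ} (hw : w ≠ 0) :
    HasDerivAt (fun w : ℝ => -(w ^ k * (w * Real.log w)) / (k + 1) + w ^ (k + 1) / ((k : ℝ) + 1) ^ 2)
      (-(w ^ k * Real.log w)) w := by
  have hk : (k : ℝ) + 1 ≠ 0 := by positivity
  have h1 := (((hasDerivAt_pow (k + 1) w).mul (Real.hasDerivAt_log hw)).neg.div_const ((k : ℝ) + 1)).add
    ((hasDerivAt_pow (k + 1) w).div_const (((k : ℝ) + 1) ^ 2))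
  refine (h1.congr_of_eventuallyEq (EventuallyEq.of_eq ?_)).congr_deriv ?_
  · ext w; simp; ring
  · push_cast
    simp
    field_simp
    ring

theorem integral_neg_pow_mul_log (k : ℕ) :
    IntegrableOn (fun w : ℝ => -(w ^ k * Real.log w)) (Set.Ioc 0 1) ∧
      ∫ w in Set.Ioc (0 : ℝ) 1, -(w ^ k * Real.log w) = 1 / ((k : ℝ) + 1) ^ 2 := by
  have hc : ContinuousOn (fun w : ℝ => -(w ^ k * (w * Real.log w)) / (k + 1) +
      w ^ (k + 1) / ((k : ℝ) + 1) ^ 2) (Set.Icc 0 1) :=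
    (((((continuous_pow k).mul Real.continuous_mul_log).neg).div_const _).add
      ((continuous_pow (k + 1)).div_const _)).continuousOn
  have hi := intervalIntegral.integrableOn_deriv_of_nonneg hc
    (fun x hx => hasDerivAt_pow_mul_log k hx.1.ne') (fun x hx => by
      have := Real.log_nonpos hx.1.le hx.2.le
      have := pow_nonneg hx.1.le k
      nlinarith)
  refine ⟨hi, ?_⟩
  rw [← intervalIntegral.integral_of_le zero_le_one,
    intervalIntegral.integral_eq_sub_of_hasDerivAt_of_le zero_le_one hc
      (fun x hx => hasDerivAt_pow_mul_log k hx.1.ne')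
      ((intervalIntegrable_iff_integrableOn_Ioc_of_le zero_le_one).2 hi)]
  simp

theorem integral_neg_log_div_one_sub :
    ∫ w in Set.Ioo (0 : ℝ) 1, -Real.log w / (1 - w) = Real.pi ^ 2 / 6 := by
  have hz : HasSum (fun k : ℕ => 1 / ((k : ℝ) + 1) ^ 2) (Real.pi ^ 2 / 6) := by
    have := (hasSum_nat_add_iff' (f := fun n : ℕ => 1 / (n : ℝ) ^ 2) 1).2 hasSum_zeta_two
    simpa using this
  have h1 : ∀ k : ℕ, ∫ w in Set.Ioo (0 : ℝ) 1, -(w ^ k * Real.log w) = 1 / ((k : ℝ) + 1) ^ 2 :=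
    fun k => by rw [← integral_Ioc_eq_integral_Ioo, (integral_neg_pow_mul_log k).2]
  have h2 := hasSum_integral_of_summable_integral_norm (μ := volume.restrict (Set.Ioo (0 : ℝ) 1))
    (F := fun (k : ℕ) w => -(w ^ k * Real.log w))
    (fun k => (integral_neg_pow_mul_log k).1.mono_set Set.Ioo_subset_Ioc_self) (by
      refine hz.summable.congr fun k => ?_
      rw [← h1]
      refine setIntegral_congr_fun measurableSet_Ioo fun w hw => ?_
      rw [Real.norm_of_nonneg]
      have := Real.log_nonpos hw.1.le hw.2.le
      have := pow_nonneg hw.1.le k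
      nlinarith)
  simp_rw [h1] at h2
  rw [← h2.unique hz]
  refine setIntegral_congr_fun measurableSet_Ioo fun w hw => ?_
  rw [tsum_neg, tsum_mul_right, tsum_geometric_of_lt_one hw.1.le hw.2]
  ring

theorem integral_log_one_add_div :
    IntegrableOn (fun z => Real.log (1 + z) / (z * (z + 1))) (Set.Ioi 0) ∧
    ∫ z in Set.Ioi (0 : ℝ), Real.log (1 + z) / (z * (z + 1)) = Real.pi ^ 2 / 6 := by
  have hder : ∀ w ∈ Set.Ioo (0 : ℝ) 1, HasDerivWithinAt (fun w : ℝ => 1 / w - 1) (-(w ^ 2)⁻¹)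
    (Set.Ioo 0 1) w := fun w hw => (hasDerivWithinAt_one_div hw.1.ne').sub_const 1
  have hinj : Set.InjOn (fun w : ℝ => 1 / w - 1) (Set.Ioo 0 1) := fun x _ y _ hxy => by
    simpa using hxy
  have heq : Set.EqOn (fun w => |-(w ^ 2)⁻¹| • (Real.log (1 + (1 / w - 1)) /
        ((1 / w - 1) * (1 / w - 1 + 1))))
      (fun w => -Real.log w / (1 - w)) (Set.Ioo 0 1) := fun w hw => by
    have h0 : 0 < w := hw.1
    have h1 : 0 < 1 - w := sub_pos.2 hw.2
    dsimp only
    rw [abs_neg, abs_of_pos (by positivity), smul_eq_mul, add_sub_cancel, one_div, Real.log_inv]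
    have : w⁻¹ - 1 = (1 - w) / w := by field_simp
    rw [this]
    field_simp
    ring
  have hi : IntegrableOn (fun w : ℝ => -Real.log w / (1 - w)) (Set.Ioo 0 1) := by
    by_contra hc
    have := integral_undef hc
    rw [integral_neg_log_div_one_sub] at this
    have h := Real.pi_pos
    have h2 : 0 < Real.pi ^ 2 / 6 := by positivity
    linarith
  have h1 := (integrableOn_image_iff_integrableOn_abs_deriv_smul measurableSet_Ioo hder
    hinj (fun z => Real.log (1 + z) / (z * (z + 1)))).2 (hi.congr_fun heq.symm measurableSet_Ioo)
  have h2 := integral_image_eq_integral_abs_deriv_smul measurableSet_Ioo hder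
    hinj (fun z => Real.log (1 + z) / (z * (z + 1)))
  rw [image_one_div_sub_one_Ioo] at h1 h2
  exact ⟨h1, by rw [h2, setIntegral_congr_fun measurableSet_Ioo heq, integral_neg_log_div_one_sub]⟩

/-- Lévy's constant. -/
theorem gaussMean_log :
    gaussMean (fun x => Real.log (1 + x) / x) +
      gaussMean (gaussOp fun x => Real.log (1 + 1 / x)) = Real.pi ^ 2 / 6 := by
  obtain ⟨h1, h2⟩ := integral_log_one_add_div
  have hU : Set.Ioc (0 : ℝ) 1 ∪ Set.Ioi 1 = Set.Ioi 0 := Set.Ioc_union_Ioi_eq_Ioi zero_le_one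
  rw [← hU] at h1 h2
  rw [setIntegral_union (Set.Ioc_disjoint_Ioi le_rfl) measurableSet_Ioi
    (h1.mono_set Set.subset_union_left) (h1.mono_set Set.subset_union_right)] at h2
  rw [gaussMean_gaussOp_eq (by simpa using h1.mono_set Set.subset_union_right), ← h2]
  congr 1
  · refine setIntegral_congr_fun measurableSet_Ioc fun σ hσ => ?_
    dsimp only
    rw [div_div, add_comm 1 σ]
  · simp

theorem gaussMean_one_add : gaussMean (fun x => 1 + x) = 1 := by
  unfold gaussMean
  rw [setIntegral_congr_fun (g := fun _ => (1 : ℝ)) measurableSet_Ioc fun σ hσ => ?_]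
  · simp
  · have := hσ.1
    exact div_self (by positivity)

theorem LipIoc.gaussMean_add {K L : ℝ} {f g : ℝ → ℝ} (hf : LipIoc K f) (hg : LipIoc L g) :
    gaussMean (fun x => f x + g x) = gaussMean f + gaussMean g := by
  unfold gaussMean
  simp_rw [add_div]
  exact integral_add hf.integrableOn hg.integrableOn

theorem gaussMean_neg_const_mul (c : ℝ) (f : ℝ → ℝ) :
    gaussMean (fun x => -(c * f x)) = -(c * gaussMean f) := by
  unfold gaussMean
  simp_rw [neg_div, mul_div_assoc, integral_neg, integral_const_mul]

theorem gaussOp_tsum {F : ℕ → ℝ → ℝ} {a : ℕ → ℝ} (ha : Summable a)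
    (hF : ∀ k, ∀ x ∈ Set.Ioc (0 : ℝ) 1, |F k x| ≤ a k) {σ : ℝ} (hσ : 0 ≤ σ) :
    gaussOp (fun x => ∑' k, F k x) σ = ∑' k, gaussOp (F k) σ := by
  have hv : (1 : ℝ) ≤ 1 + σ := by linarith
  have ha0 : ∀ k, 0 ≤ a k := fun k => (abs_nonneg _).trans (hF k 1 ⟨one_pos, le_rfl⟩)
  have hs : Summable (Function.uncurry fun (j k : ℕ) =>
      digitWeight (1 + σ) j * F k (1 / (1 + σ + j))) := by
    refine Summable.of_norm_bounded ((hasSum_digitWeight (by linarith)).summable.mul_of_nonneg ha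
      (fun j => digitWeight_nonneg (v := 1 + σ) (by linarith) j) ha0) fun ⟨j, k⟩ => ?_
    simp only [Function.uncurry, norm_mul, Real.norm_eq_abs]
    rw [abs_of_nonneg (digitWeight_nonneg (by linarith) j)]
    exact mul_le_mul_of_nonneg_left (hF k _ (one_div_add_nat_mem hv j))
      (digitWeight_nonneg (by linarith) j)
  simp only [gaussOp, digitAvg, ← tsum_mul_left]
  exact hs.tsum_comm.symm

/-- Solvability of the Poisson equation for the square of the Gauss operator. -/
theorem LipIoc.exists_poisson {K : ℝ} {r : ℝ → ℝ} (hr : LipIoc K r) (hK : 0 ≤ K)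
    (h0 : gaussMean r = 0) : ∃ (B : ℝ → ℝ) (C : ℝ), (∀ x ∈ Set.Ioc (0 : ℝ) 1, |B x| ≤ C) ∧
      ∀ x ∈ Set.Ioc (0 : ℝ) 1, B x - _root_.gaussOp (_root_.gaussOp B) x = r x := by
  have hl : ∀ k : ℕ, LipIoc ((9 / 10) ^ k * K) (_root_.gaussOp^[k] r) ∧
      gaussMean (_root_.gaussOp^[k] r) = 0 := fun k => by
    induction k with
    | zero => simpa using ⟨hr, h0⟩
    | succ k ih =>
      rw [Function.iterate_succ_apply', ih.1.gaussMean_gaussOp]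
      exact ⟨by rw [pow_succ', mul_assoc]; exact ih.1.gaussOp (by positivity), ih.2⟩
  have hb : ∀ k : ℕ, ∀ x ∈ Set.Ioc (0 : ℝ) 1, |_root_.gaussOp^[k] r x| ≤ (9 / 10) ^ k * K :=
    fun k x hx => (hl k).1.abs_le_of_gaussMean_eq_zero (by positivity) (hl k).2 hx
  have hs : Summable (fun k : ℕ => (9 / 10 : ℝ) ^ k * K) :=
    (summable_geometric_of_lt_one (by norm_num) (by norm_num)).mul_right K
  have hinj : Function.Injective fun j : ℕ => 2 * j := fun a b h => by simpa using h
  have hs2 : Summable (fun j : ℕ => (9 / 10 : ℝ) ^ (2 * j) * K) := hs.comp_injective hinj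
  have hs3 : Summable (fun j : ℕ => (9 / 10 : ℝ) ^ (2 * j + 1) * K) :=
    hs.comp_injective (i := fun j : ℕ => 2 * j + 1) fun a b h => by simpa using h
  refine ⟨fun x => ∑' j : ℕ, _root_.gaussOp^[2 * j] r x, ∑' j : ℕ, (9 / 10 : ℝ) ^ (2 * j) * K,
    fun x hx => ?_, fun x hx => ?_⟩
  · rw [← Real.norm_eq_abs]
    exact tsum_of_norm_bounded hs2.hasSum fun j => hb _ x hx
  · have e1 : ∀ y : ℝ, 0 ≤ y → _root_.gaussOp (fun x => ∑' j : ℕ, _root_.gaussOp^[2 * j] r x) y =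
        ∑' j : ℕ, _root_.gaussOp^[2 * j + 1] r y := fun y hy => by
      rw [gaussOp_tsum hs2 (fun j x hx => hb _ x hx) hy]
      simp_rw [Function.iterate_succ_apply']
    have e2 : _root_.gaussOp (_root_.gaussOp (fun x => ∑' j : ℕ, _root_.gaussOp^[2 * j] r x)) x =
        _root_.gaussOp (fun y => ∑' j : ℕ, _root_.gaussOp^[2 * j + 1] r y) x := by
      simp only [_root_.gaussOp, digitAvg]
      congr 1; ext j
      congr 1
      refine (e1 _ (one_div_add_nat_mem (by linarith [hx.1]) j).1.le)
    rw [e2, gaussOp_tsum hs3 (fun j x hx => hb _ x hx) hx.1.le]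
    dsimp only
    have hs4 : Summable fun j : ℕ => _root_.gaussOp^[2 * j] r x :=
      Summable.of_norm_bounded hs2 fun j => hb _ x hx
    rw [hs4.tsum_eq_zero_add]
    simp_rw [← Function.iterate_succ_apply' _root_.gaussOp]
    simp [mul_add]

/-- The corrector turning `log Q` into a martingale up to the drift of `1 / τ`. -/
theorem exists_corrector : ∃ (ψ : ℝ → ℝ) (C : ℝ), (∀ u : ℝ, 1 ≤ u → |ψ u| ≤ C) ∧
    ∀ τ ∈ Set.Ioc (0 : ℝ) 1, ψ (1 / τ) - digitAvg (fun x => ψ (1 + x)) τ =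
      digitAvg (fun x => Real.log (1 + 1 / x)) τ -
        Real.pi ^ 2 / 6 * (digitAvg (fun x => 1 + x) τ - 1 / τ) := by
  have hc : 0 ≤ Real.pi ^ 2 / 6 := by positivity
  have hl1 := lipIoc_one_add.gaussOp zero_le_one
  have hl2 := lipIoc_log_one_add_div.add lipIoc_gaussOp_log
  have hr := hl2.add (hl1.const_mul hc)
  obtain ⟨B, C, hB, hP⟩ := hr.exists_poisson (by positivity) (by
    rw [hl2.gaussMean_add (hl1.const_mul hc), lipIoc_log_one_add_div.gaussMean_add lipIoc_gaussOp_log,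
      gaussMean_log, gaussMean_neg_const_mul, lipIoc_one_add.gaussMean_gaussOp, gaussMean_one_add]
    ring)
  refine ⟨digitAvg B, C, fun u hu => abs_digitAvg_le hu hB, fun τ hτ => ?_⟩
  have h0 : 0 < τ := hτ.1
  have hx : ∀ j : ℕ, 0 < 1 / (τ + j) := fun j => by positivity
  have h1 : digitAvg B (1 / τ) = 1 / (1 / τ + 1) * B τ +
      1 / τ / (1 / τ + 1) * digitAvg B (1 + 1 / τ) := by
    have h1τ : 1 ≤ 1 / τ := (one_le_div h0).2 hτ.2
    rw [digitAvg_eq (by positivity) (summable_digitWeight_mul_of_bdd (C := C) (by positivity)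
      fun j => hB _ (one_div_add_nat_mem h1τ j)), one_div_one_div]
  rw [h1, digitAvg_eq h0 (f := fun x => digitAvg B (1 + x)) (summable_digitWeight_mul_of_bdd h0
      fun j => abs_digitAvg_le (by linarith [hx j]) hB),
    digitAvg_eq h0 (f := fun x => Real.log (1 + 1 / x)) (summable_digitWeight_mul h0 (C := 4)
      fun j => by simpa using abs_log_one_add_le h0.le (by linarith [hτ.2]) j),
    digitAvg_eq h0 (f := fun x => 1 + x) (summable_digitWeight_mul_of_bdd h0 (C := 1 + 1 / τ)
      fun j => by
        rw [abs_of_nonneg (by linarith [hx j])]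
        gcongr
        linarith [(Nat.cast_nonneg j : (0 : ℝ) ≤ j)])]
  have h2 := hP τ hτ
  have h3 : gaussOp (gaussOp B) τ = digitAvg (fun x => digitAvg B (1 + x)) (1 + τ) := rfl
  rw [h3] at h2
  simp only [gaussOp] at h2
  rw [show B τ = Real.log (1 + τ) / τ + digitAvg (fun x => Real.log (1 + 1 / x)) (1 + τ) +
      -(Real.pi ^ 2 / 6 * digitAvg (fun x => 1 + x) (1 + τ)) +
      digitAvg (fun x => digitAvg B (1 + x)) (1 + τ) by linarith, one_div_one_div]
  field_simp
  ring

/-- The law of the tail `T^n t` given the past, with parameter `τ = 1 - Q_{n-1} / Q_n`. -/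
noncomputable def tailDensity (τ t : ℝ) : ℝ := τ / (1 - (1 - τ) * t) ^ 2

/-- The digit minus two. -/
noncomputable def excess (t : ℝ) : ℕ := ⌈1 / t⌉.toNat - 2

theorem tail_denom_pos {τ t : ℝ} (hτ : τ ∈ Set.Ioc (0 : ℝ) 1) (_h0 : 0 ≤ t) (h1 : t ≤ 1) :
    0 < 1 - (1 - τ) * t := by
  nlinarith [hτ.1, hτ.2]

theorem excess_one_div {t : ℝ} (b : ℕ) (h0 : 0 ≤ t)
    (h1 : t < 1) : excess (1 / (b + 2 - t)) = b := by
  have : ⌈(b : ℝ) + 2 - t⌉ = ((b + 2 : ℕ) : ℤ) := by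
    rw [Int.ceil_eq_iff]
    push_cast
    constructor <;> linarith
  rw [excess, one_div_one_div, this, Int.toNat_natCast, Nat.add_sub_cancel]

theorem negT_one_div {t : ℝ} (b : ℕ) (h0 : 0 ≤ t) (h1 : t < 1) : negT (1 / (b + 2 - t)) = t := by
  rw [negT, neg_div, one_div_one_div, Int.fract_eq_iff]
  exact ⟨h0, h1, -(b + 2), by push_cast; ring⟩

theorem image_one_div_sub_Ico (b : ℕ) :
    (fun t : ℝ => 1 / ((b : ℝ) + 2 - t)) '' Set.Ico 0 1 =
      Set.Ico (1 / ((b : ℝ) + 2)) (1 / ((b : ℝ) + 1)) := by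
  have hb : (0 : ℝ) ≤ b := by positivity
  ext s
  constructor
  · rintro ⟨t, ⟨h0, h1⟩, rfl⟩
    exact ⟨one_div_le_one_div_of_le (by linarith) (by linarith),
      one_div_lt_one_div_of_lt (by linarith) (by linarith)⟩
  · rintro ⟨h1, h2⟩
    have hs : 0 < s := lt_of_lt_of_le (by positivity) h1
    rw [div_le_iff₀ (by positivity)] at h1
    rw [lt_div_iff₀ (by positivity)] at h2
    refine ⟨b + 2 - 1 / s, ⟨?_, ?_⟩, by simp⟩
    · rw [sub_nonneg, div_le_iff₀ hs]; linarith
    · have : (b : ℝ) + 1 < 1 / s := by rw [lt_div_iff₀ hs]; linarith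
      linarith

theorem iUnion_Ico_one_div :
    ⋃ b : ℕ, Set.Ico (1 / ((b : ℝ) + 2)) (1 / ((b : ℝ) + 1)) = Set.Ioo 0 1 := by
  ext s
  simp only [Set.mem_iUnion]
  constructor
  · rintro ⟨b, h1, h2⟩
    refine ⟨lt_of_lt_of_le (by positivity) h1, lt_of_lt_of_le h2 ?_⟩
    rw [div_le_one (by positivity)]
    linarith [(Nat.cast_nonneg b : (0 : ℝ) ≤ b)]
  · rintro ⟨h0, h1⟩
    have h2 : 1 < 1 / s := (one_lt_div h0).2 h1
    have h3 : 2 ≤ ⌈1 / s⌉₊ := by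
      have : 1 < ⌈1 / s⌉₊ := Nat.lt_ceil.2 (by simpa using h2)
      omega
    obtain ⟨b, hb⟩ := Nat.exists_eq_add_of_le' h3
    have h4 := Nat.le_ceil (1 / s)
    have h5 := Nat.ceil_lt_add_one (a := 1 / s) (by positivity)
    rw [hb] at h4 h5
    push_cast at h4 h5
    refine ⟨b, ?_, ?_⟩
    · rw [div_le_iff₀ h0] at h4
      rw [div_le_iff₀ (by positivity)]; linarith
    · have h6 : (b : ℝ) + 1 < 1 / s := by linarith
      rw [lt_div_iff₀ h0] at h6
      rw [lt_div_iff₀ (by positivity)]; linarith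

theorem pairwise_disjoint_Ico_one_div : Pairwise (Function.onFun Disjoint fun b : ℕ =>
    Set.Ico (1 / ((b : ℝ) + 2)) (1 / ((b : ℝ) + 1))) := by
  refine (pairwise_disjoint_on _).2 fun i j hij => Set.disjoint_left.2 fun z h1 h2 => ?_
  have h3 : (i : ℝ) + 1 ≤ j := by exact_mod_cast hij
  have h4 : 1 / ((j : ℝ) + 1) ≤ 1 / ((i : ℝ) + 2) :=
    one_div_le_one_div_of_le (by positivity) (by linarith)
  linarith [h1.1, h2.2]

theorem lintegral_tailDensity_eq_tsum {τ : ℝ} (hτ : τ ∈ Set.Ioc (0 : ℝ) 1) (h : ℝ → ENNReal) :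
    ∫⁻ t in Set.Ioo (0 : ℝ) 1, h t * ENNReal.ofReal (tailDensity τ t) =
      ∑' b : ℕ, ENNReal.ofReal (digitWeight τ b) * ∫⁻ t in Set.Ioo (0 : ℝ) 1,
        h (1 / (b + 2 - t)) * ENNReal.ofReal (tailDensity ((b + τ) / (b + 1 + τ)) t) := by
  conv_lhs => rw [← iUnion_Ico_one_div, lintegral_iUnion (fun _ => measurableSet_Ico)
    pairwise_disjoint_Ico_one_div]
  congr 1; ext b
  have hb : (0 : ℝ) ≤ b := by positivity
  have h0 : 0 < τ := hτ.1
  have hder : ∀ t ∈ Set.Ico (0 : ℝ) 1, HasDerivWithinAt (fun t : ℝ => 1 / ((b : ℝ) + 2 - t))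
      (1 / ((b : ℝ) + 2 - t) ^ 2) (Set.Ico 0 1) t := fun t ht => by
    have hne : (b : ℝ) + 2 - t ≠ 0 := by linarith [ht.2]
    have := (((hasDerivAt_id' t).const_sub ((b : ℝ) + 2)).fun_inv hne).hasDerivWithinAt
      (s := Set.Ico 0 1)
    simpa using this
  have hinj : Set.InjOn (fun t : ℝ => 1 / ((b : ℝ) + 2 - t)) (Set.Ico 0 1) := fun x _ y _ hxy => by
    simpa using hxy
  rw [← image_one_div_sub_Ico, lintegral_image_eq_lintegral_abs_deriv_mul measurableSet_Ico hder hinj,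
    ← lintegral_const_mul' _ _ ENNReal.ofReal_ne_top, setLIntegral_congr Ioo_ae_eq_Ico.symm]
  refine setLIntegral_congr_fun measurableSet_Ioo fun t ht => ?_
  have ht1 : 0 < (b : ℝ) + 2 - t := by linarith [ht.2]
  have ht2 : 0 < (b : ℝ) + 1 + τ - t := by linarith [ht.2]
  rw [mul_left_comm, mul_left_comm (ENNReal.ofReal _) (h _), ← ENNReal.ofReal_mul (by positivity),
    ← ENNReal.ofReal_mul (digitWeight_nonneg h0 b)]
  congr 2
  unfold tailDensity digitWeight
  rw [abs_of_nonneg (by positivity)]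
  have e1 : 1 - (1 - τ) * (1 / ((b : ℝ) + 2 - t)) = (b + 1 + τ - t) / (b + 2 - t) := by
    field_simp; ring
  have e2 : 1 - (1 - ((b : ℝ) + τ) / (b + 1 + τ)) * t = (b + 1 + τ - t) / (b + 1 + τ) := by
    field_simp; ring
  rw [e1, e2]
  field_simp
  ring

theorem lintegral_tailDensity {τ : ℝ} (hτ : τ ∈ Set.Ioc (0 : ℝ) 1) :
    ∫⁻ t in Set.Ioo (0 : ℝ) 1, ENNReal.ofReal (tailDensity τ t) = 1 := by
  have hd : ∀ t ∈ Set.Icc (0 : ℝ) 1,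
      HasDerivAt (fun t => τ * t / (1 - (1 - τ) * t)) (tailDensity τ t) t := fun t ht => by
    have hp := tail_denom_pos hτ ht.1 ht.2
    have h1 := ((hasDerivAt_id t).const_mul τ).div
      (((hasDerivAt_id t).const_mul (1 - τ)).const_sub 1) hp.ne'
    refine h1.congr_deriv ?_
    unfold tailDensity
    simp only [id]
    congr 1
    ring
  have hc : ContinuousOn (tailDensity τ) (Set.Icc 0 1) := by
    unfold tailDensity
    refine continuousOn_const.div (by fun_prop) fun t ht => ?_
    have := tail_denom_pos hτ ht.1 ht.2
    positivity
  have hi : IntervalIntegrable (tailDensity τ) volume 0 1 :=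
    hc.intervalIntegrable_of_Icc zero_le_one
  have h2 := intervalIntegral.integral_eq_sub_of_hasDerivAt (a := 0) (b := 1)
    (fun t ht => hd t (by simpa using ht)) hi
  rw [intervalIntegral.integral_of_le zero_le_one, integral_Ioc_eq_integral_Ioo] at h2
  have h3 : IntegrableOn (tailDensity τ) (Set.Ioo 0 1) :=
    (hc.integrableOn_compact isCompact_Icc).mono_set Set.Ioo_subset_Icc_self
  rw [← ofReal_integral_eq_lintegral_ofReal h3 (ae_of_all _ fun t => ?_), h2]
  · simp [hτ.1.ne']
  · unfold tailDensity
    have := hτ.1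
    dsimp only [Pi.zero_apply]
    positivity

section Drift

variable {α : Type*}

/-- The state reached from `a` after reading `n` digits of `t`. -/
noncomputable def digitPath (step : α → ℕ → α) : ℕ → α → ℝ → α
  | 0, a, _ => a
  | n + 1, a, t => digitPath step n (step a (excess t)) (negT t)

theorem measurable_excess : Measurable excess := by
  unfold excess
  exact (measurable_of_countable fun k : ℤ => k.toNat - 2).comp
    (Int.measurable_ceil.comp (measurable_const.div measurable_id))

theorem measurable_negT : Measurable negT := by
  unfold negT
  exact measurable_fract.comp (measurable_const.div measurable_id)

theorem measurable_comp_digitPath {β : Type*} [MeasurableSpace β] (step : α → ℕ → α) (Φ : α → β)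
    (n : ℕ) (a : α) : Measurable fun t => Φ (digitPath step n a t) := by
  induction n generalizing a with
  | zero => simp only [digitPath]; exact measurable_const
  | succ n ih =>
    have : Measurable (fun p : ℕ × ℝ => Φ (digitPath step n (step a p.1) p.2)) :=
      measurable_from_prod_countable_right fun b => ih (step a b)
    exact this.comp (measurable_excess.prodMk measurable_negT)

/-- A drift condition along the digits bounds expectations of the final state. -/
theorem lintegral_digitPath_le (τ : α → ℝ) (step : α → ℕ → α)
    (hstep : ∀ a b, τ (step a b) = (b + τ a) / (b + 1 + τ a)) (Inv : ℕ → α → Prop)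
    (hτ : ∀ n a, Inv n a → τ a ∈ Set.Ioc (0 : ℝ) 1)
    (hInv : ∀ n a b, Inv (n + 1) a → Inv n (step a b)) (V : ℕ → α → ENNReal)
    (hV : ∀ n a, Inv (n + 1) a →
      ∑' b : ℕ, ENNReal.ofReal (digitWeight (τ a) b) * V n (step a b) ≤ V (n + 1) a)
    (n : ℕ) (a : α) (ha : Inv n a) :
    ∫⁻ t in Set.Ioo (0 : ℝ) 1, V 0 (digitPath step n a t) * ENNReal.ofReal (tailDensity (τ a) t) ≤
      V n a := by
  induction n generalizing a with
  | zero =>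
    simp only [digitPath]
    rw [lintegral_const_mul _ (by unfold tailDensity; fun_prop), lintegral_tailDensity (hτ _ _ ha), mul_one]
  | succ n ih =>
    rw [lintegral_tailDensity_eq_tsum (hτ _ _ ha)]
    refine le_trans (ENNReal.tsum_le_tsum fun b => ?_) (hV n a ha)
    refine mul_le_mul_right ?_ _
    refine le_trans (le_of_eq ?_) (ih (step a b) (hInv n a b ha))
    refine setLIntegral_congr_fun measurableSet_Ioo fun t ht => ?_
    rw [digitPath, excess_one_div b ht.1.le ht.2, negT_one_div b ht.1.le ht.2, hstep]

end Drift

theorem digitAvg_nonneg {f : ℝ → ℝ} {v : ℝ} (hv : 0 < v) (hf : ∀ x, 0 < x → 0 ≤ f x) :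
    0 ≤ digitAvg f v :=
  tsum_nonneg fun j => mul_nonneg (digitWeight_nonneg hv j) (hf _ (by positivity))

theorem one_div_add_nat_le {v : ℝ} (hv : 0 < v) (j : ℕ) : 1 / (v + j) ≤ 1 / v :=
  one_div_le_one_div_of_le hv (by linarith [(Nat.cast_nonneg j : (0 : ℝ) ≤ j)])

theorem summable_digitWeight_mul_one_add {τ : ℝ} (hτ : 0 < τ) :
    Summable fun j : ℕ => digitWeight τ j * (1 + 1 / (τ + j)) :=
  summable_digitWeight_mul_of_bdd hτ (C := 1 + 1 / τ) fun j => by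
    rw [abs_of_nonneg (by positivity)]
    linarith [one_div_add_nat_le hτ j]

theorem summable_digitWeight_mul_mulLog {τ : ℝ} (hτ : 0 < τ) :
    Summable fun j : ℕ => digitWeight τ j * ((1 + 1 / (τ + j)) * Real.log (1 + 1 / (τ + j))) :=
  summable_digitWeight_mul_of_bdd hτ (C := (1 + 1 / τ) * (1 / τ)) fun j => by
    have h0 : 0 < 1 / (τ + j) := by positivity
    have h1 : 0 ≤ Real.log (1 + 1 / (τ + j)) := Real.log_nonneg (by linarith)
    have h2 : Real.log (1 + 1 / (τ + j)) ≤ 1 / (τ + j) := by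
      linarith [Real.log_le_sub_one_of_pos (show 0 < 1 + 1 / (τ + j) by linarith)]
    have h3 := one_div_add_nat_le hτ j
    rw [abs_of_nonneg (by positivity)]
    exact mul_le_mul (by linarith) (h2.trans h3) h1 (by positivity)

theorem digitAvg_one_add_mem {τ : ℝ} (hτ : 0 < τ) :
    1 / τ + τ / (τ + 1) ≤ digitAvg (fun x => 1 + x) τ ∧
      digitAvg (fun x => 1 + x) τ ≤ 1 / τ + 2 * (τ / (τ + 1)) := by
  rw [digitAvg_eq (f := fun x => 1 + x) hτ (summable_digitWeight_mul_one_add hτ)]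
  have h1 : 1 / (τ + 1) * (1 + 1 / τ) = 1 / τ := by field_simp
  have h2 : digitAvg (fun x => 1 + x) (1 + τ) ≤ 2 := by
    refine (le_abs_self _).trans (abs_digitAvg_le (by linarith) fun x hx => ?_)
    rw [abs_of_nonneg (by linarith [hx.1])]; linarith [hx.2]
  have h3 : 1 ≤ digitAvg (fun x => 1 + x) (1 + τ) := by
    refine (hasSum_digitWeight (v := 1 + τ) (by linarith)).tsum_eq.symm.trans_le ?_
    unfold digitAvg
    refine Summable.tsum_le_tsum (fun j => ?_)
      (hasSum_digitWeight (v := 1 + τ) (by linarith)).summable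
      (summable_digitWeight_mul_one_add (τ := 1 + τ) (by linarith))
    refine le_mul_of_one_le_right (digitWeight_nonneg (by linarith) j) ?_
    have : 0 < 1 / (1 + τ + (j : ℝ)) := by positivity
    linarith
  have h4 : 0 < τ / (τ + 1) := by positivity
  rw [h1]
  constructor <;> nlinarith

/-- The defect of `u ↦ u log u` from having unit drift. -/
noncomputable def driftErr (τ : ℝ) : ℝ :=
  1 - (digitAvg (fun x => (1 + x) * Real.log (1 + x)) τ - 1 / τ * Real.log (1 / τ))

theorem abs_driftErr_le {τ : ℝ} (hτ : 0 < τ) : |driftErr τ| ≤ 2 * (τ / (τ + 1)) := by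
  have hlog : ∀ x : ℝ, 0 < x → 0 ≤ Real.log (1 + x) ∧ Real.log (1 + x) ≤ x := fun x hx =>
    ⟨Real.log_nonneg (by linarith), by
      linarith [Real.log_le_sub_one_of_pos (show 0 < 1 + x by linarith)]⟩
  unfold driftErr
  rw [digitAvg_eq (f := fun x => (1 + x) * Real.log (1 + x)) hτ
    (summable_digitWeight_mul_mulLog hτ)]
  have h1 : 1 / (τ + 1) * ((1 + 1 / τ) * Real.log (1 + 1 / τ)) = 1 / τ * Real.log (1 + 1 / τ) := by
    field_simp
  have h2 : digitAvg (fun x => (1 + x) * Real.log (1 + x)) (1 + τ) ≤ 2 := by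
    refine (le_abs_self _).trans (abs_digitAvg_le (by linarith) fun x hx => ?_)
    have := hlog x hx.1
    rw [abs_of_nonneg (mul_nonneg (by linarith [hx.1]) this.1)]
    nlinarith [hx.1, hx.2]
  have h3 : 0 ≤ digitAvg (fun x => (1 + x) * Real.log (1 + x)) (1 + τ) :=
    digitAvg_nonneg (by linarith) fun x hx => mul_nonneg (by linarith) (hlog x hx).1
  have h5 : Real.log (1 + 1 / τ) - Real.log (1 / τ) = Real.log (1 + τ) := by
    rw [← Real.log_div (by positivity) (by positivity)]
    congr 1
    field_simp
    ring
  have h6 : 1 / τ * Real.log (1 + 1 / τ) - 1 / τ * Real.log (1 / τ) = Real.log (1 + τ) / τ := by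
    rw [← mul_sub, h5]; ring
  have h7 : Real.log (1 + τ) / τ ≤ 1 := (div_le_one hτ).2 (hlog τ hτ).2
  have h8 : 1 - τ / (τ + 1) ≤ Real.log (1 + τ) / τ := by
    have := Real.one_sub_inv_le_log_of_pos (show 0 < 1 + τ by linarith)
    rw [le_div_iff₀ hτ]
    refine le_trans (le_of_eq ?_) this
    field_simp; ring
  have h4 : 0 < τ / (τ + 1) := by positivity
  have h9 : τ / (τ + 1) * digitAvg (fun x => (1 + x) * Real.log (1 + x)) (1 + τ) ≤
    τ / (τ + 1) * 2 := mul_le_mul_of_nonneg_left h2 h4.le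
  have h10 := mul_nonneg h4.le h3
  rw [h1, _root_.abs_le]
  constructor <;> linarith

theorem digitAvg_mulLog_le {τ : ℝ} (hτ : τ ∈ Set.Ioc (0 : ℝ) 1) :
    digitAvg (fun x => (1 + x) * Real.log (1 + x)) τ ≤ 1 / τ * Real.log (1 / τ) + 2 := by
  have h1 := (_root_.abs_le.1 (abs_driftErr_le hτ.1)).1
  have h2 : τ / (τ + 1) ≤ 1 / 2 := by
    rw [div_le_div_iff₀ (by linarith [hτ.1]) (by norm_num)]; linarith [hτ.2]
  unfold driftErr at h1
  linarith

theorem le_add_mulLog_div {η u : ℝ} (hη : 1 < η) (hu : 1 ≤ u) :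
    u ≤ η + u * Real.log u / Real.log η := by
  have hl : 0 < Real.log η := Real.log_pos hη
  have hu0 : 0 ≤ Real.log u := Real.log_nonneg hu
  rcases le_total u η with h | h
  · have : 0 ≤ u * Real.log u / Real.log η := by positivity
    linarith
  · have h1 : Real.log η ≤ Real.log u := Real.log_le_log (by linarith) h
    have : u ≤ u * Real.log u / Real.log η := by
      rw [le_div_iff₀ hl]; exact mul_le_mul_of_nonneg_left h1 (by linarith)
    linarith

theorem log_sq_le {z : ℝ} (hz : 1 ≤ z) : Real.log z ^ 2 ≤ 16 * √z := by
  have h1 := log_le_mul_sqrt (x := √z) (Real.sqrt_pos.2 (by linarith))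
  rw [Real.log_sqrt (by linarith)] at h1
  have h2 : Real.log z ≤ 4 * √(√z) := by linarith
  calc Real.log z ^ 2 ≤ (4 * √(√z)) ^ 2 := pow_le_pow_left₀ (Real.log_nonneg hz) h2 2
    _ = 16 * √z := by rw [mul_pow, Real.sq_sqrt (Real.sqrt_nonneg z)]; norm_num

theorem log_one_add_sq_le {v : ℝ} (hv : 0 ≤ v) (hv2 : v ≤ 2) (j : ℕ) :
    |Real.log (1 + (v + j)) ^ 2| ≤ 48 * √((j : ℝ) + 1) := by
  have hj : (0 : ℝ) ≤ j := by positivity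
  rw [abs_of_nonneg (sq_nonneg _)]
  refine (log_sq_le (by linarith)).trans ?_
  have : √(1 + (v + j)) ≤ √(3 ^ 2 * ((j : ℝ) + 1)) := Real.sqrt_le_sqrt (by linarith)
  rw [Real.sqrt_mul (by norm_num), Real.sqrt_sq (by norm_num)] at this
  linarith

/-- The second moments of the increments of `log Q` are bounded. -/
theorem exists_secondMoment_bound : ∃ S : ℝ, 0 ≤ S ∧ ∀ τ ∈ Set.Ioc (0 : ℝ) 1,
    ∑' j : ℕ, digitWeight τ j * Real.log (1 + (τ + j)) ^ 2 ≤ S := by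
  refine ⟨2 * 48 * ∑' j : ℕ, √((j : ℝ) + 1) / ((j : ℝ) + 1) ^ 2,
    mul_nonneg (by norm_num) (tsum_nonneg fun j => by positivity), fun τ hτ => ?_⟩
  rw [← tsum_mul_left]
  have hb := log_one_add_sq_le hτ.1.le (by linarith [hτ.2] : τ ≤ 2)
  refine (summable_digitWeight_mul hτ.1 hb).tsum_le_tsum (fun j => ?_)
    (summable_sqrt_div_sq.mul_left _)
  refine ((le_abs_self _).trans (norm_digitWeight_mul_le hτ.1 hb j)).trans ?_
  have : 0 ≤ √((j : ℝ) + 1) / ((j : ℝ) + 1) ^ 2 := by positivity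
  gcongr
  linarith [hτ.2]

theorem tsum_ofReal_digitWeight_le {τ R : ℝ} (hτ : 0 < τ) {h : ℕ → ℝ} (hh : ∀ j, 0 ≤ h j)
    (hs : Summable fun j => digitWeight τ j * h j) (hR : ∑' j, digitWeight τ j * h j ≤ R) :
    ∑' j, ENNReal.ofReal (digitWeight τ j) * ENNReal.ofReal (h j) ≤ ENNReal.ofReal R := by
  simp_rw [← ENNReal.ofReal_mul (digitWeight_nonneg hτ _)]
  rw [← ENNReal.ofReal_tsum_of_nonneg (fun j => mul_nonneg (digitWeight_nonneg hτ j) (hh j)) hs]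
  exact ENNReal.ofReal_le_ofReal hR

/-- The state of the digit chain: the logarithm of `Q`, the accumulated `driftErr`, and `τ`. -/
noncomputable def digitStep (a : ℝ × ℝ × ℝ) (b : ℕ) : ℝ × ℝ × ℝ :=
  (a.1 + Real.log (b + 1 + a.2.2), a.2.1 + driftErr a.2.2, (b + a.2.2) / (b + 1 + a.2.2))

theorem one_div_digitStep {a : ℝ × ℝ × ℝ} (h : 0 < a.2.2) (b : ℕ) :
    1 / (digitStep a b).2.2 = 1 + 1 / (a.2.2 + b) := by
  simp only [digitStep]
  have : (b : ℝ) + a.2.2 ≠ 0 := by positivity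
  rw [add_comm (a.2.2) (b : ℝ)]
  field_simp
  ring

/-- Admissible states with `k` digits still to be read. -/
def Admissible (M : ℝ) (k : ℕ) (a : ℝ × ℝ × ℝ) : Prop :=
  a.2.2 ∈ Set.Ioc (0 : ℝ) 1 ∧ 1 / a.2.2 + k ≤ M

theorem Admissible.step {M : ℝ} {k : ℕ} {a : ℝ × ℝ × ℝ} (h : Admissible M (k + 1) a) (b : ℕ) :
    Admissible M k (digitStep a b) := by
  have h0 := h.1.1
  refine ⟨⟨by simp only [digitStep]; positivity, ?_⟩, ?_⟩
  · simp only [digitStep]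
    rw [div_le_one (by positivity)]; linarith
  · rw [one_div_digitStep h0]
    have h1 := one_div_add_nat_le h0 b
    have h2 := h.2
    push_cast at h2
    linarith

theorem Admissible.lintegral_le {M : ℝ} (V : ℕ → ℝ × ℝ × ℝ → ℝ) (hV0 : ∀ k a, Admissible M k a → 0 ≤ V k a)
    (hV : ∀ k a, Admissible M (k + 1) a →
      Summable (fun b => digitWeight a.2.2 b * V k (digitStep a b)) ∧
      ∑' b, digitWeight a.2.2 b * V k (digitStep a b) ≤ V (k + 1) a)
    {n : ℕ} (hn : 1 + (n : ℝ) ≤ M) :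
    ∫⁻ t in Set.Ioo (0 : ℝ) 1, ENNReal.ofReal (V 0 (digitPath digitStep n (0, 0, 1) t)) ≤
      ENNReal.ofReal (V n (0, 0, 1)) := by
  have h := lintegral_digitPath_le (fun a : ℝ × ℝ × ℝ => a.2.2) digitStep (fun _ _ => rfl)
    (Admissible M) (fun n a h => h.1) (fun n a b h => h.step b) (fun k a => ENNReal.ofReal (V k a))
    (fun k a ha => tsum_ofReal_digitWeight_le ha.1.1 (fun b => hV0 _ _ (ha.step b)) (hV k a ha).1
      (hV k a ha).2) n (0, 0, 1) ⟨by simp, by simpa using hn⟩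
  simpa [tailDensity] using h

theorem Admissible.digitPath {M : ℝ} {n : ℕ} {a : ℝ × ℝ × ℝ} (h : Admissible M n a) (t : ℝ) :
    Admissible M 0 (_root_.digitPath digitStep n a t) := by
  induction n generalizing a t with
  | zero => exact h
  | succ n ih => exact ih (h.step _) _

theorem admissible_start {M : ℝ} {n : ℕ} (hn : 1 + (n : ℝ) ≤ M) :
    Admissible M n ((0, 0, 1) : ℝ × ℝ × ℝ) := ⟨by simp, by simpa using hn⟩

theorem one_le_one_div_of_mem {τ : ℝ} (hτ : τ ∈ Set.Ioc (0 : ℝ) 1) : 1 ≤ 1 / τ :=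
  (one_le_div hτ.1).2 hτ.2

theorem mulLog_nonneg {u : ℝ} (hu : 1 ≤ u) : 0 ≤ u * Real.log u :=
  mul_nonneg (by linarith) (Real.log_nonneg hu)

theorem hasSum_digitWeight_const_mul_add {τ A B s : ℝ} (hτ : 0 < τ) {h : ℕ → ℝ}
    (hs : HasSum (fun j => digitWeight τ j * h j) s) :
    HasSum (fun j => digitWeight τ j * (A + B * h j)) (A + B * s) := by
  have := ((hasSum_digitWeight hτ).mul_right A).add (hs.mul_left B)
  rw [one_mul] at this
  have heq : (fun j => digitWeight τ j * (A + B * h j)) =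
      fun j => digitWeight τ j * A + B * (digitWeight τ j * h j) := by
    funext j; ring
  rwa [heq]

theorem hasSum_digitAvg_mulLog {τ : ℝ} (hτ : 0 < τ) :
    HasSum (fun j : ℕ => digitWeight τ j * ((1 + 1 / (τ + j)) * Real.log (1 + 1 / (τ + j))))
      (digitAvg (fun x => (1 + x) * Real.log (1 + x)) τ) :=
  (summable_digitWeight_mul_mulLog hτ).hasSum

theorem hasSum_digitAvg_one_add {τ : ℝ} (hτ : 0 < τ) :
    HasSum (fun j : ℕ => digitWeight τ j * (1 + 1 / (τ + j))) (digitAvg (fun x => 1 + x) τ) :=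
  (summable_digitWeight_mul_one_add hτ).hasSum

theorem lintegral_one_div_tau_le {η : ℝ} (hη : 1 < η) (n : ℕ) :
    ∫⁻ t in Set.Ioo (0 : ℝ) 1, ENNReal.ofReal (1 / (digitPath digitStep n (0, 0, 1) t).2.2) ≤
      ENNReal.ofReal (η + 2 * n / Real.log η) := by
  have hl : 0 < Real.log η := Real.log_pos hη
  have h := Admissible.lintegral_le (M := 1 + n)
    (fun k a => (η + 2 * k / Real.log η) + 1 / Real.log η * (1 / a.2.2 * Real.log (1 / a.2.2)))
    (fun k a ha => by
      have := mulLog_nonneg (one_le_one_div_of_mem ha.1)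
      positivity)
    (fun k a ha => by
      have h0 := ha.1.1
      have h1 := hasSum_digitWeight_const_mul_add (A := η + 2 * k / Real.log η)
        (B := 1 / Real.log η) h0 (hasSum_digitAvg_mulLog h0)
      simp_rw [one_div_digitStep h0]
      refine ⟨h1.summable, ?_⟩
      rw [h1.tsum_eq]
      have h2 := mul_le_mul_of_nonneg_left (digitAvg_mulLog_le ha.1) (one_div_pos.2 hl).le
      refine (add_le_add_right h2 _).trans (le_of_eq ?_)
      push_cast
      ring) (n := n) le_rfl
  refine (lintegral_mono fun t => ENNReal.ofReal_le_ofReal ?_).trans (h.trans (le_of_eq (by simp)))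
  have ha := ((admissible_start (n := n) le_rfl).digitPath t).1
  refine (le_add_mulLog_div hη (one_le_one_div_of_mem ha)).trans (le_of_eq ?_)
  push_cast
  ring

theorem lintegral_driftErr_le {η : ℝ} (hη : 1 < η) (n : ℕ) :
    ∫⁻ t in Set.Ioo (0 : ℝ) 1, ENNReal.ofReal |(digitPath digitStep n (0, 0, 1) t).2.1| ≤
      ENNReal.ofReal (2 * η + 4 * n / Real.log η) := by
  have hl : 0 < Real.log η := Real.log_pos hη
  have hnn : ∀ τ ∈ Set.Ioc (0 : ℝ) 1,
      0 ≤ η + 1 / τ * Real.log (1 / τ) / Real.log η - 1 / τ := fun τ hτ =>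
    sub_nonneg.2 (le_add_mulLog_div hη (one_le_one_div_of_mem hτ))
  have h := Admissible.lintegral_le (M := 1 + n)
    (fun k a => |a.2.1| + 2 * (η + 1 / a.2.2 * Real.log (1 / a.2.2) / Real.log η - 1 / a.2.2) +
      4 * k / Real.log η)
    (fun k a ha => by
      have := hnn _ ha.1
      positivity)
    (fun k a ha => by
      have h0 := ha.1.1
      have h1 := (hasSum_digitWeight_const_mul_add (A := |a.2.1 + driftErr a.2.2| + 2 * η +
        4 * k / Real.log η) (B := 2 / Real.log η) h0 (hasSum_digitAvg_mulLog h0)).sub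
          ((hasSum_digitAvg_one_add h0).mul_left 2)
      have h2 : ∀ b : ℕ, (digitStep a b).2.1 = a.2.1 + driftErr a.2.2 := fun b => rfl
      simp_rw [one_div_digitStep h0, h2]
      have h1' : HasSum (fun b : ℕ => digitWeight a.2.2 b * (|a.2.1 + driftErr a.2.2| +
          2 * (η + (1 + 1 / (a.2.2 + b)) * Real.log (1 + 1 / (a.2.2 + b)) / Real.log η -
            (1 + 1 / (a.2.2 + b))) + 4 * k / Real.log η))
          (|a.2.1 + driftErr a.2.2| + 2 * η + 4 * k / Real.log η + 2 / Real.log η *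
            digitAvg (fun x => (1 + x) * Real.log (1 + x)) a.2.2 -
              2 * digitAvg (fun x => 1 + x) a.2.2) := by
        refine (congrArg (fun f : ℕ → ℝ => HasSum f _) (funext fun b => ?_)).mp h1
        ring
      refine ⟨h1'.summable, ?_⟩
      rw [h1'.tsum_eq]
      have h3 := mul_le_mul_of_nonneg_left (digitAvg_mulLog_le ha.1) (div_pos two_pos hl).le
      have h4 := (digitAvg_one_add_mem h0).1
      have h5 := (abs_add_le a.2.1 (driftErr a.2.2)).trans
        (add_le_add_right (abs_driftErr_le h0) _)
      have h6 : 2 / Real.log η * (1 / a.2.2 * Real.log (1 / a.2.2) + 2) =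
          2 * (1 / a.2.2 * Real.log (1 / a.2.2) / Real.log η) + 4 / Real.log η := by ring
      have h7 : 4 * ((k + 1 : ℕ) : ℝ) / Real.log η = 4 * k / Real.log η + 4 / Real.log η := by
        push_cast; ring
      rw [h7]
      linarith) (n := n) le_rfl
  refine (lintegral_mono fun t => ENNReal.ofReal_le_ofReal ?_).trans
    (h.trans (ENNReal.ofReal_le_ofReal ?_))
  · have := hnn _ ((admissible_start (n := n) le_rfl).digitPath t).1
    push_cast
    have h0 : 4 * (0 : ℝ) / Real.log η = 0 := by simp
    linarith
  · simp

theorem hasSum_digitWeight_ite {τ : ℝ} (hτ : 0 < τ) :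
    HasSum (fun j : ℕ => digitWeight τ j * if j = 0 then 0 else 1) (τ / (τ + 1)) := by
  have h := (hasSum_digitWeight hτ).sub (hasSum_ite_eq (0 : ℕ) (digitWeight τ 0))
  have heq : (fun j : ℕ => digitWeight τ j * if j = 0 then (0 : ℝ) else 1) =
      fun j => digitWeight τ j - if j = 0 then digitWeight τ 0 else 0 := by
    funext j
    by_cases hj : j = 0
    · subst hj; simp
    · simp [hj]
  have hv : τ / (τ + 1) = 1 - digitWeight τ 0 := by
    rw [digitWeight_zero hτ]; field_simp; ring
  rwa [heq, hv]

theorem tsum_sq_le {τ y a l Dm S : ℝ} (hτ : 0 < τ) {Z F D : ℕ → ℝ}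
    (hZ : HasSum (fun j => digitWeight τ j * Z j) 0) (hZF : ∀ j, Z j = a + l * F j + D j)
    (hD0 : D 0 = 0) (hD : ∀ j, |D (j + 1)| ≤ Dm)
    (hF : Summable fun j => digitWeight τ j * F j ^ 2)
    (hS : ∑' j, digitWeight τ j * F j ^ 2 ≤ S) :
    Summable (fun j => digitWeight τ j * (y + Z j) ^ 2) ∧
      ∑' j, digitWeight τ j * (y + Z j) ^ 2 ≤
        y ^ 2 + (2 * l ^ 2 * S + 2 * Dm ^ 2 * (τ / (τ + 1))) := by
  have h1 := ((hasSum_digitWeight_const_mul_add (A := y ^ 2) (B := 2 * y + 2 * a) hτ hZ).add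
    (hF.hasSum.mul_left (2 * l ^ 2))).add ((hasSum_digitWeight_ite hτ).mul_left (2 * Dm ^ 2))
  have hle : ∀ j, digitWeight τ j * (y + Z j) ^ 2 ≤
      digitWeight τ j * (y ^ 2 + (2 * y + 2 * a) * Z j) +
        2 * l ^ 2 * (digitWeight τ j * F j ^ 2) +
        2 * Dm ^ 2 * (digitWeight τ j * if j = 0 then 0 else 1) := fun j => by
    have h2 : (y + Z j) ^ 2 ≤ y ^ 2 + (2 * y + 2 * a) * Z j + 2 * l ^ 2 * F j ^ 2 +
        2 * Dm ^ 2 * (if j = 0 then 0 else 1) := by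
      have h3 : (y + Z j) ^ 2 ≤ y ^ 2 + (2 * y + 2 * a) * Z j + (2 * l ^ 2 * F j ^ 2 + 2 * D j ^ 2) := by
        rw [hZF]
        nlinarith [sq_nonneg (l * F j - D j), sq_nonneg a]
      have h4 : D j ^ 2 ≤ Dm ^ 2 * (if j = 0 then 0 else 1) := by
        cases j with
        | zero => simp [hD0]
        | succ j =>
          simp only [Nat.succ_ne_zero, if_false, mul_one]
          exact sq_le_sq' (_root_.abs_le.1 (hD j)).1 (_root_.abs_le.1 (hD j)).2
      linarith
    have := mul_le_mul_of_nonneg_left h2 (digitWeight_nonneg hτ j)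
    refine this.trans (le_of_eq ?_)
    ring
  have hs : Summable (fun j => digitWeight τ j * (y + Z j) ^ 2) :=
    Summable.of_nonneg_of_le (fun j => mul_nonneg (digitWeight_nonneg hτ j) (sq_nonneg _)) hle
      h1.summable
  refine ⟨hs, (hs.tsum_le_tsum hle h1.summable).trans ?_⟩
  rw [h1.tsum_eq]
  have := mul_le_mul_of_nonneg_left hS (show 0 ≤ 2 * l ^ 2 by positivity)
  linarith

/-- The correction turning `l * log Q` into a martingale, as a function of `u = 1 / τ`. -/
noncomputable def correction (ψ : ℝ → ℝ) (c l u : ℝ) : ℝ := l * ψ u - c * (u * (l - Real.log u))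

/-- The martingale built from `l * log Q`. -/
noncomputable def corrected (ψ : ℝ → ℝ) (c l : ℝ) (n k : ℕ) (a : ℝ × ℝ × ℝ) : ℝ :=
  l * a.1 + correction ψ c l (1 / a.2.2) + c * a.2.1 + c * k - (c * n + correction ψ c l 1)

/-- The increments of `corrected`. -/
noncomputable def correctedStep (ψ : ℝ → ℝ) (c l τ : ℝ) (b : ℕ) : ℝ :=
  l * Real.log (1 + (τ + b)) - c + correction ψ c l (1 + 1 / (τ + b)) -
    correction ψ c l (1 / τ) + c * driftErr τ

theorem corrected_digitStep {ψ : ℝ → ℝ} {c l : ℝ} {n k : ℕ} {a : ℝ × ℝ × ℝ} (h : 0 < a.2.2) (b : ℕ) :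
    corrected ψ c l n k (digitStep a b) =
      corrected ψ c l n (k + 1) a + correctedStep ψ c l a.2.2 b := by
  unfold corrected correctedStep
  rw [one_div_digitStep h]
  simp only [digitStep]
  rw [show (b : ℝ) + 1 + a.2.2 = 1 + (a.2.2 + b) by ring]
  push_cast
  ring

theorem hasSum_correctedStep {ψ : ℝ → ℝ} {c l C τ : ℝ} (hψ : ∀ u, 1 ≤ u → |ψ u| ≤ C)
    (hτ : τ ∈ Set.Ioc (0 : ℝ) 1)
    (hcor : ψ (1 / τ) - digitAvg (fun x => ψ (1 + x)) τ =
      digitAvg (fun x => Real.log (1 + 1 / x)) τ - c * (digitAvg (fun x => 1 + x) τ - 1 / τ)) :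
    HasSum (fun b => digitWeight τ b * correctedStep ψ c l τ b) 0 := by
  have h0 := hτ.1
  have hF : HasSum (fun b : ℕ => digitWeight τ b * Real.log (1 + (τ + b)))
      (digitAvg (fun x => Real.log (1 + 1 / x)) τ) := by
    have := (summable_digitWeight_mul h0
      (abs_log_one_add_le h0.le (by linarith [hτ.2] : τ ≤ 2))).hasSum
    unfold digitAvg
    simpa only [one_div_one_div] using this
  have hψ' : HasSum (fun b : ℕ => digitWeight τ b * ψ (1 + 1 / (τ + b)))
      (digitAvg (fun x => ψ (1 + x)) τ) :=
    (summable_digitWeight_mul_of_bdd h0 (C := C) fun b => hψ _ (by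
      have : 0 < 1 / (τ + (b : ℝ)) := by positivity
      linarith)).hasSum
  have h := (((((hasSum_digitWeight h0).mul_right
    (-c - correction ψ c l (1 / τ) + c * driftErr τ)).add (hF.mul_left l)).add
    (hψ'.mul_left l)).add ((hasSum_digitAvg_one_add h0).mul_left (-(c * l)))).add
    ((hasSum_digitAvg_mulLog h0).mul_left c)
  have heq : (fun b => digitWeight τ b * correctedStep ψ c l τ b) = fun b : ℕ =>
      digitWeight τ b * (-c - correction ψ c l (1 / τ) + c * driftErr τ) +
        l * (digitWeight τ b * Real.log (1 + (τ + b))) +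
        l * (digitWeight τ b * ψ (1 + 1 / (τ + b))) +
        -(c * l) * (digitWeight τ b * (1 + 1 / (τ + b))) +
        c * (digitWeight τ b * ((1 + 1 / (τ + b)) * Real.log (1 + 1 / (τ + b)))) := by
    funext b
    unfold correctedStep
    rw [correction.eq_1 ψ c l (1 + _)]
    ring
  rw [heq]
  refine (congrArg (HasSum _) ?_).mp h
  unfold driftErr correction
  linear_combination (-l) * hcor

theorem mul_log_div_sq_le {M z δ : ℝ} (hz : 1 ≤ z) (hzM : z ≤ M) (hδ : 0 < δ) :
    z * (Real.log M - Real.log z) ^ 2 ≤ 8 * (δ * M + z / δ) := by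
  have hz0 : 0 < z := by linarith
  rw [← Real.log_div (by linarith) hz0.ne']
  have h1 := log_sq_le (z := M / z) ((one_le_div hz0).2 hzM)
  have h2 : z * √(M / z) ≤ (δ * M + z / δ) / 2 := by
    have h3 : √(M / z) ^ 2 = M / z := Real.sq_sqrt (div_nonneg (by linarith) hz0.le)
    set s := √(M / z)
    have hM : M = z * s ^ 2 := by rw [h3]; field_simp
    have h4 : (δ * M + z / δ) / 2 - z * s = z / δ * (δ * s - 1) ^ 2 / 2 := by
      rw [hM]; field_simp; ring
    have : 0 ≤ z / δ * (δ * s - 1) ^ 2 / 2 := by positivity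
    linarith
  calc z * Real.log (M / z) ^ 2 ≤ z * (16 * √(M / z)) := mul_le_mul_of_nonneg_left h1 hz0.le
    _ = 16 * (z * √(M / z)) := by ring
    _ ≤ 16 * ((δ * M + z / δ) / 2) := by gcongr
    _ = _ := by ring

theorem abs_correction_le {ψ : ℝ → ℝ} {c l C u : ℝ} (hψ : ∀ u, 1 ≤ u → |ψ u| ≤ C) (hc : 0 ≤ c)
    (hl : 0 ≤ l) (hu : 1 ≤ u) (hul : Real.log u ≤ l) :
    |correction ψ c l u| ≤ l * C + c * (u * (l - Real.log u)) := by
  unfold correction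
  have h1 : 0 ≤ c * (u * (l - Real.log u)) :=
    mul_nonneg hc (mul_nonneg (by linarith) (by linarith))
  refine (abs_sub _ _).trans ?_
  rw [abs_mul, abs_of_nonneg hl, abs_of_nonneg h1]
  have := mul_le_mul_of_nonneg_left (hψ u hu) hl
  linarith

theorem tsum_corrected_sq_le {ψ : ℝ → ℝ} {c C S M η δ τ y : ℝ} (hψ : ∀ u, 1 ≤ u → |ψ u| ≤ C)
    (hc : 0 ≤ c) (hτ : τ ∈ Set.Ioc (0 : ℝ) 1)
    (hcor : ψ (1 / τ) - digitAvg (fun x => ψ (1 + x)) τ =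
      digitAvg (fun x => Real.log (1 + 1 / x)) τ - c * (digitAvg (fun x => 1 + x) τ - 1 / τ))
    (hS : ∑' j : ℕ, digitWeight τ j * Real.log (1 + (τ + j)) ^ 2 ≤ S)
    (hM : 1 ≤ Real.log M) (hτM : 1 / τ + 1 ≤ M) (hη : 1 < η) (hδ : 0 < δ) :
    Summable (fun j => digitWeight τ j * (y + correctedStep ψ c (Real.log M) τ j) ^ 2) ∧
      ∑' j, digitWeight τ j * (y + correctedStep ψ c (Real.log M) τ j) ^ 2 ≤
        y ^ 2 + ((2 * S + 4 * (2 * C + 2 * c) ^ 2) * Real.log M ^ 2 +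
          32 * c ^ 2 * (δ * M + (η + 1) / δ) +
          32 * c ^ 2 / (δ * Real.log η) * (1 / τ * Real.log (1 / τ))) := by
  have h0 := hτ.1
  have hu := one_le_one_div_of_mem hτ
  set l := Real.log M
  set z := 1 / τ + 1 with hz
  have hz1 : 1 ≤ z := by linarith
  have hzl : Real.log z ≤ l := Real.log_le_log (by linarith) hτM
  set Dm := (2 * C + 2 * c) * l + c * (z * (l - Real.log z)) with hDm
  have hC : 0 ≤ C := (abs_nonneg _).trans (hψ 1 le_rfl)
  obtain ⟨hs, hle⟩ := tsum_sq_le (y := y) (a := correctedStep ψ c l τ 0 - l * Real.log (1 + (τ + (0 : ℕ))))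
    (l := l) (Dm := Dm) (S := S) (Z := correctedStep ψ c l τ)
    (F := fun j : ℕ => Real.log (1 + (τ + j)))
    (D := fun j : ℕ => correction ψ c l (1 + 1 / (τ + j)) - correction ψ c l (1 + 1 / τ)) h0
    (hasSum_correctedStep hψ hτ hcor) (fun j => by
      unfold correctedStep
      simp only [Nat.cast_zero, add_zero]
      ring) (by simp) (fun j => by
      have hx : 0 < 1 / (τ + ((j + 1 : ℕ) : ℝ)) := by positivity
      have hx1 : 1 / (τ + ((j + 1 : ℕ) : ℝ)) ≤ 1 := by
        rw [div_le_one (by positivity)]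
        push_cast
        linarith [(Nat.cast_nonneg j : (0 : ℝ) ≤ j)]
      set v := 1 + 1 / (τ + ((j + 1 : ℕ) : ℝ))
      have hv1 : 1 ≤ v := by linarith
      have hv2 : v ≤ 2 := by linarith
      have hvl0 := Real.log_nonneg hv1
      have hvl : Real.log v ≤ 1 := by
        linarith [Real.log_le_sub_one_of_pos (show 0 < v by linarith)]
      have h1 := abs_correction_le hψ hc (by linarith) hv1 (hvl.trans hM)
      have h2 := abs_correction_le hψ hc (by linarith) hz1 hzl
      have h3 : c * (v * (l - Real.log v)) ≤ c * (2 * l) :=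
        mul_le_mul_of_nonneg_left
          (mul_le_mul hv2 (by linarith) (by linarith) (by norm_num)) hc
      rw [hz, add_comm (1 / τ) 1] at h2
      refine (abs_sub _ _).trans ?_
      rw [hDm, hz, add_comm (1 / τ) 1]
      linarith)
    (summable_digitWeight_mul h0 (log_one_add_sq_le h0.le (by linarith [hτ.2]))) hS
  refine ⟨hs, hle.trans ?_⟩
  have hτz : τ / (τ + 1) = 1 / z := by rw [hz]; field_simp; ring
  have h1 : Dm ^ 2 * (1 / z) ≤ 2 * (2 * C + 2 * c) ^ 2 * l ^ 2 +
      2 * c ^ 2 * (z * (l - Real.log z) ^ 2) := by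
    have h2 : Dm ^ 2 ≤ 2 * ((2 * C + 2 * c) * l) ^ 2 + 2 * (c * (z * (l - Real.log z))) ^ 2 := by
      rw [hDm]
      nlinarith [sq_nonneg ((2 * C + 2 * c) * l - c * (z * (l - Real.log z)))]
    have h3 : 1 / z ≤ 1 := by rw [div_le_one (by linarith)]; exact hz1
    calc Dm ^ 2 * (1 / z) ≤ (2 * ((2 * C + 2 * c) * l) ^ 2 +
          2 * (c * (z * (l - Real.log z))) ^ 2) * (1 / z) :=
          mul_le_mul_of_nonneg_right h2 (by positivity)
      _ = 2 * ((2 * C + 2 * c) * l) ^ 2 * (1 / z) +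
          2 * c ^ 2 * (z * (l - Real.log z) ^ 2) := by field_simp
      _ ≤ 2 * ((2 * C + 2 * c) * l) ^ 2 * 1 + 2 * c ^ 2 * (z * (l - Real.log z) ^ 2) := by
          gcongr
      _ = _ := by ring
  have h4 := mul_le_mul_of_nonneg_left (mul_log_div_sq_le hz1 hτM hδ) (sq_nonneg c)
  have h5 := le_add_mulLog_div hη hu
  have hlη := Real.log_pos hη
  have h6 : z / δ ≤ (η + 1) / δ + 1 / (δ * Real.log η) * (1 / τ * Real.log (1 / τ)) := by
    have : (η + 1) / δ + 1 / (δ * Real.log η) * (1 / τ * Real.log (1 / τ)) =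
      (η + 1 + 1 / τ * Real.log (1 / τ) / Real.log η) / δ := by field_simp
    rw [this]
    gcongr
    linarith
  have h7 := mul_le_mul_of_nonneg_left h6 (sq_nonneg c)
  rw [hτz]
  have h8 : 32 * c ^ 2 / (δ * Real.log η) * (1 / τ * Real.log (1 / τ)) =
    32 * (c ^ 2 * (1 / (δ * Real.log η) * (1 / τ * Real.log (1 / τ)))) := by ring
  rw [h8]
  linarith

theorem lintegral_corrected_sq_le {ψ : ℝ → ℝ} {c C S η δ : ℝ} (hψ : ∀ u, 1 ≤ u → |ψ u| ≤ C)
    (hc : 0 ≤ c)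
    (hcor : ∀ τ ∈ Set.Ioc (0 : ℝ) 1, ψ (1 / τ) - digitAvg (fun x => ψ (1 + x)) τ =
      digitAvg (fun x => Real.log (1 + 1 / x)) τ - c * (digitAvg (fun x => 1 + x) τ - 1 / τ))
    (hS0 : 0 ≤ S) (hS : ∀ τ ∈ Set.Ioc (0 : ℝ) 1,
      ∑' j : ℕ, digitWeight τ j * Real.log (1 + (τ + j)) ^ 2 ≤ S)
    (n : ℕ) (hn : 1 ≤ Real.log (1 + n)) (hη : 1 < η) (hδ : 0 < δ) :
    ∫⁻ t in Set.Ioo (0 : ℝ) 1, ENNReal.ofReal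
        (corrected ψ c (Real.log (1 + n)) n 0 (digitPath digitStep n (0, 0, 1) t) ^ 2) ≤
      ENNReal.ofReal (((2 * S + 4 * (2 * C + 2 * c) ^ 2) * Real.log (1 + n) ^ 2 +
          32 * c ^ 2 * (δ * (1 + n) + (η + 1) / δ)) * n +
          32 * c ^ 2 / (δ * Real.log η) * n ^ 2) := by
  have hlη := Real.log_pos hη
  set α := (2 * S + 4 * (2 * C + 2 * c) ^ 2) * Real.log (1 + n) ^ 2 +
          32 * c ^ 2 * (δ * (1 + n) + (η + 1) / δ) with hα
  have hα0 : 0 ≤ α := by positivity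
  set β := 32 * c ^ 2 / (δ * Real.log η) with hβ
  have hβ0 : 0 ≤ β := by positivity
  have h := Admissible.lintegral_le (M := 1 + n) (n := n)
    (fun k a => corrected ψ c (Real.log (1 + n)) n k a ^ 2 + (α * k + β * k ^ 2) +
      β * k * (1 / a.2.2 * Real.log (1 / a.2.2)))
    (fun k a ha => by
      have := mulLog_nonneg (one_le_one_div_of_mem ha.1)
      positivity)
    (fun k a ha => by
      have h0 := ha.1.1
      have hM : 1 / a.2.2 + 1 ≤ 1 + n := by
        have := ha.2
        push_cast at this
        linarith [(Nat.cast_nonneg k : (0 : ℝ) ≤ k)]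
      obtain ⟨hs, hle⟩ := tsum_corrected_sq_le (y := corrected ψ c (Real.log (1 + n)) n (k + 1) a)
        hψ hc ha.1 (hcor _ ha.1) (hS _ ha.1) hn hM hη hδ
      have h1 := hs.hasSum.add (hasSum_digitWeight_const_mul_add (A := α * k + β * k ^ 2)
        (B := β * k) h0 (hasSum_digitAvg_mulLog h0))
      simp_rw [one_div_digitStep h0, corrected_digitStep h0]
      have heq : (fun b : ℕ => digitWeight a.2.2 b *
          ((corrected ψ c (Real.log (1 + n)) n (k + 1) a +
            correctedStep ψ c (Real.log (1 + n)) a.2.2 b) ^ 2 + (α * k + β * k ^ 2) +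
          β * k * ((1 + 1 / (a.2.2 + b)) * Real.log (1 + 1 / (a.2.2 + b))))) = fun b : ℕ =>
          digitWeight a.2.2 b * (corrected ψ c (Real.log (1 + n)) n (k + 1) a +
            correctedStep ψ c (Real.log (1 + n)) a.2.2 b) ^ 2 +
          digitWeight a.2.2 b * ((α * k + β * k ^ 2) +
            β * k * ((1 + 1 / (a.2.2 + b)) * Real.log (1 + 1 / (a.2.2 + b)))) := by
        funext b; ring
      rw [heq]
      refine ⟨h1.summable, ?_⟩
      rw [h1.tsum_eq]
      have h2 := mul_le_mul_of_nonneg_left (digitAvg_mulLog_le ha.1)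
        (show 0 ≤ β * k by positivity)
      rw [← hα, ← hβ] at hle
      push_cast
      nlinarith) (by linarith)
  refine (lintegral_mono fun t => ENNReal.ofReal_le_ofReal ?_).trans
    (h.trans (le_of_eq ?_))
  · simp
  · simp only [corrected]
    congr 1
    norm_num
    ring

theorem volume_inter_le_of_lintegral_le {f : ℝ → ℝ} (hf : Measurable f) {B r : ℝ} (hr : 0 < r)
    {s : Set ℝ} (h : ∫⁻ t in s, ENNReal.ofReal (f t) ≤ ENNReal.ofReal B) :
    volume ({t | r ≤ f t} ∩ s) ≤ ENNReal.ofReal (B / r) := by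
  have hm : MeasurableSet {t | r ≤ f t} := hf measurableSet_Ici
  rw [← Measure.restrict_apply hm, ENNReal.ofReal_div_of_pos hr]
  refine le_trans (measure_mono fun t (ht : r ≤ f t) => ENNReal.ofReal_le_ofReal ht)
    ((meas_ge_le_lintegral_div hf.ennreal_ofReal.aemeasurable (ENNReal.ofReal_pos.2 hr).ne'
      ENNReal.ofReal_ne_top).trans ?_)
  gcongr

theorem tendsto_one_add_natCast : Tendsto (fun n : ℕ => 1 + (n : ℝ)) atTop atTop :=
  tendsto_atTop_add_const_left _ _ tendsto_natCast_atTop_atTop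

theorem tendsto_log_one_add_natCast : Tendsto (fun n : ℕ => Real.log (1 + n)) atTop atTop :=
  Real.tendsto_log_atTop.comp tendsto_one_add_natCast

theorem tendsto_log_pow_div_one_add (k : ℕ) :
    Tendsto (fun n : ℕ => Real.log (1 + n) ^ k / (1 + n)) atTop (nhds 0) :=
  (isLittleO_pow_log_id_atTop (n := k)).tendsto_div_nhds_zero.comp tendsto_one_add_natCast

theorem tendsto_one_div_sqrt {f : ℕ → ℝ} (hf : Tendsto f atTop atTop) :
    Tendsto (fun n => 1 / √(f n)) atTop (nhds 0) := by
  simp only [one_div]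
  exact (Real.tendsto_sqrt_atTop.comp hf).inv_tendsto_atTop

theorem tendsto_one_add_natCast_div : Tendsto (fun n : ℕ => (1 + (n : ℝ)) / n) atTop (nhds 1) := by
  have h := (tendsto_one_div_atTop_nhds_zero_nat (𝕜 := ℝ)).add_const 1
  rw [zero_add] at h
  refine h.congr' ?_
  filter_upwards [eventually_gt_atTop 0] with n hn
  field_simp

theorem tendsto_sqrt_log_div_sqrt :
    Tendsto (fun n : ℕ => √(Real.log (1 + n)) / √(1 + n)) atTop (nhds 0) := by
  have h := (Real.continuous_sqrt.tendsto 0).comp (tendsto_log_pow_div_one_add 1)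
  rw [Real.sqrt_zero] at h
  refine h.congr fun n => ?_
  simp only [Function.comp_apply, pow_one]
  exact Real.sqrt_div' _ (by positivity)

theorem tendsto_secondMoment_div (K c : ℝ) :
    Tendsto (fun n : ℕ => ((K * Real.log (1 + n) ^ 2 + 32 * c ^ 2 *
      (1 / √(Real.log (1 + n)) * (1 + n) + (√(1 + n) + 1) / (1 / √(Real.log (1 + n))))) * n +
        32 * c ^ 2 / (1 / √(Real.log (1 + n)) * Real.log √(1 + n)) * n ^ 2) / (n : ℝ) ^ 2)
      atTop (nhds 0) := by
  have h1 := (tendsto_log_pow_div_one_add 2).const_mul K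
  have h2 := tendsto_one_div_sqrt tendsto_log_one_add_natCast
  have h3 := tendsto_sqrt_log_div_sqrt
  have h4 := h3.mul (tendsto_one_div_sqrt tendsto_one_add_natCast)
  have h := ((h1.add (((h2.add h3).add h4).const_mul (32 * c ^ 2))).mul
    tendsto_one_add_natCast_div).add (h2.const_mul (64 * c ^ 2))
  simp only [mul_zero, zero_mul, add_zero] at h
  refine h.congr' ?_
  filter_upwards [eventually_gt_atTop 0] with n hn
  have hn0 : (0 : ℝ) < n := by exact_mod_cast hn
  have hs : 0 < √(1 + (n : ℝ)) := Real.sqrt_pos.2 (by linarith)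
  have hl : 0 < √(Real.log (1 + n)) := Real.sqrt_pos.2 (Real.log_pos (by linarith))
  have hs2 : 1 + (n : ℝ) = √(1 + (n : ℝ)) ^ 2 := (Real.sq_sqrt (by linarith)).symm
  have hl2 : Real.log (1 + n) = √(Real.log (1 + n)) ^ 2 :=
    (Real.sq_sqrt (Real.log_pos (by linarith)).le).symm
  rw [Real.log_sqrt (by linarith)]
  generalize √(Real.log (1 + n)) = l at *
  rw [hl2]
  generalize √(1 + (n : ℝ)) = s at *
  rw [hs2]
  field_simp
  ring

theorem tendsto_firstMoment_div (a b : ℝ) :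
    Tendsto (fun n : ℕ => (a * √(1 + n) + b * n / Real.log √(1 + n)) / (n : ℝ)) atTop (nhds 0) := by
  have h1 := ((tendsto_one_div_sqrt tendsto_one_add_natCast).mul
    tendsto_one_add_natCast_div).const_mul a
  have h2 := (tendsto_log_one_add_natCast.inv_tendsto_atTop).const_mul (2 * b)
  have h := h1.add h2
  simp only [mul_zero, zero_mul, add_zero] at h
  refine h.congr' ?_
  filter_upwards [eventually_gt_atTop 0] with n hn
  have hn0 : (0 : ℝ) < n := by exact_mod_cast hn
  have hs : 0 < √(1 + (n : ℝ)) := Real.sqrt_pos.2 (by linarith)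
  have hs2 : 1 + (n : ℝ) = √(1 + (n : ℝ)) ^ 2 := (Real.sq_sqrt (by linarith)).symm
  have hl : 0 < Real.log (1 + n) := Real.log_pos (by linarith)
  rw [Real.log_sqrt (by linarith)]
  simp only [Pi.inv_apply]
  generalize Real.log (1 + n) = l at *
  generalize √(1 + (n : ℝ)) = s at *
  rw [hs2]
  field_simp

theorem abs_mul_logQ_sub_le {ψ : ℝ → ℝ} {c C : ℝ} (hψ : ∀ u, 1 ≤ u → |ψ u| ≤ C) (hc : 0 ≤ c)
    {n : ℕ} (hn : 0 < Real.log (1 + n)) {a : ℝ × ℝ × ℝ} (ha : Admissible (1 + n) 0 a) :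
    |Real.log (1 + n) * a.1 - c * n| ≤ |corrected ψ c (Real.log (1 + n)) n 0 a| + c * |a.2.1| +
      2 * c * √((1 + n) * (1 / a.2.2)) + (2 * C + c) * Real.log (1 + n) := by
  have h1 := one_le_one_div_of_mem ha.1
  have h2 : 1 / a.2.2 ≤ 1 + n := by simpa using ha.2
  have h3 := abs_correction_le hψ hc hn.le h1 (Real.log_le_log (by linarith) h2)
  have h4 := abs_correction_le hψ hc hn.le le_rfl (by simpa using hn.le)
  rw [Real.log_one, sub_zero, one_mul] at h4
  set u := 1 / a.2.2
  have h5 : u * (Real.log (1 + n) - Real.log u) ≤ 2 * √((1 + n) * u) := by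
    have hu : 0 < u := by linarith
    rw [← Real.log_div (by positivity) hu.ne']
    have h6 := mul_le_mul_of_nonneg_left (log_le_mul_sqrt (x := (1 + n) / u) (by positivity)) hu.le
    have h7 : √((1 + n) * u) = u * √((1 + n) / u) := by
      rw [show (1 + n) * u = u ^ 2 * ((1 + n) / u) by field_simp, Real.sqrt_mul (sq_nonneg u),
        Real.sqrt_sq hu.le]
    rw [h7]
    linarith
  have h6 := mul_le_mul_of_nonneg_left h5 hc
  have h7 : Real.log (1 + n) * a.1 - c * n = corrected ψ c (Real.log (1 + n)) n 0 a -
      correction ψ c (Real.log (1 + n)) u - c * a.2.1 + correction ψ c (Real.log (1 + n)) 1 := by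
    unfold corrected
    push_cast
    ring
  rw [h7]
  have h8 : |c * a.2.1| = c * |a.2.1| := by rw [abs_mul, abs_of_nonneg hc]
  refine (abs_add_le _ _).trans ((add_le_add_left ((abs_sub _ _).trans
    (add_le_add_left (abs_sub _ _) _)) _).trans ?_)
  linarith

/-- A weak law of large numbers for `log Q`. -/
theorem tendsto_volume_logQ {ε : ℝ} (hε : 0 < ε) :
    Tendsto (fun n : ℕ => volume {t : ℝ | t ∈ Set.Ioo (0 : ℝ) 1 ∧
      ε * n < |Real.log (1 + n) * (digitPath digitStep n (0, 0, 1) t).1 - Real.pi ^ 2 / 6 * n|})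
      atTop (nhds 0) := by
  obtain ⟨ψ, C, hψ, hcor⟩ := exists_corrector
  obtain ⟨S, hS0, hS⟩ := exists_secondMoment_bound
  have hc : 0 < Real.pi ^ 2 / 6 := by positivity
  set c := Real.pi ^ 2 / 6
  have t1 := ENNReal.tendsto_ofReal ((tendsto_secondMoment_div
    (2 * S + 4 * (2 * C + 2 * c) ^ 2) c).const_mul (16 / ε ^ 2))
  have t2 := ENNReal.tendsto_ofReal ((tendsto_firstMoment_div 2 4).const_mul (4 * c / ε))
  have t3 := ENNReal.tendsto_ofReal ((tendsto_firstMoment_div 1 2).const_mul (128 * c ^ 2 / ε ^ 2))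
  have t := (t1.add t2).add t3
  simp only [mul_zero, ENNReal.ofReal_zero, add_zero] at t
  refine tendsto_of_tendsto_of_tendsto_of_le_of_le' tendsto_const_nhds t
    (Eventually.of_forall fun _ => bot_le) ?_
  have hlog : ∀ᶠ n : ℕ in atTop, (2 * C + c) * Real.log (1 + n) / n < ε / 4 := by
    have h := ((tendsto_log_pow_div_one_add 1).mul tendsto_one_add_natCast_div).const_mul (2 * C + c)
    simp only [mul_zero, zero_mul] at h
    filter_upwards [h.eventually_lt_const (show 0 < ε / 4 by positivity),
      eventually_gt_atTop 0] with n hn hn1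
    have hn0 : (0 : ℝ) < n := by exact_mod_cast hn1
    refine lt_of_eq_of_lt ?_ hn
    field_simp
  filter_upwards [hlog, eventually_ge_atTop 1, tendsto_log_one_add_natCast.eventually_ge_atTop 1]
    with n hn1 hn2 hn3
  have hn0 : (1 : ℝ) ≤ n := by exact_mod_cast hn2
  have hη : 1 < √(1 + (n : ℝ)) := by
    rw [Real.lt_sqrt (by norm_num)]; linarith
  have hδ : 0 < 1 / √(Real.log (1 + n)) := one_div_pos.2 (Real.sqrt_pos.2 (by linarith))
  have b1 := volume_inter_le_of_lintegral_le (r := (ε * n / 4) ^ 2)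
    (measurable_comp_digitPath digitStep (fun a => corrected ψ c (Real.log (1 + n)) n 0 a ^ 2) n
      (0, 0, 1)) (by positivity)
    (lintegral_corrected_sq_le hψ hc.le hcor hS0 hS n hn3 hη hδ)
  have b2 := volume_inter_le_of_lintegral_le (r := ε * n / (4 * c))
    (measurable_comp_digitPath digitStep (fun a => |a.2.1|) n (0, 0, 1)) (by positivity)
    (lintegral_driftErr_le hη n)
  have b3 := volume_inter_le_of_lintegral_le (r := ε ^ 2 * n / (128 * c ^ 2))
    (measurable_comp_digitPath digitStep (fun a => 1 / a.2.2) n (0, 0, 1)) (by positivity)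
    (lintegral_one_div_tau_le hη n)
  refine (measure_mono ?_).trans ((measure_union_le _ _).trans (add_le_add ((measure_union_le _ _).trans
    (add_le_add (b1.trans (le_of_eq ?_)) (b2.trans (le_of_eq ?_)))) (b3.trans (le_of_eq ?_))))
  · rintro t ⟨ht, hbad⟩
    by_contra hcon
    simp only [Set.mem_union, Set.mem_inter_iff, Set.mem_ofPred_eq, ht, and_true, not_or, not_le]
      at hcon
    obtain ⟨⟨g1, g2⟩, g3⟩ := hcon
    have hadm := (admissible_start (n := n) le_rfl).digitPath t
    have h := abs_mul_logQ_sub_le hψ hc.le (by linarith) hadm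
    have k1 := abs_lt_of_sq_lt_sq g1 (by positivity)
    have k2 : c * |(digitPath digitStep n (0, 0, 1) t).2.1| < ε * n / 4 := by
      rw [lt_div_iff₀ (by positivity)] at g2
      linarith
    have k3 : 2 * c * √((1 + n) * (1 / (digitPath digitStep n (0, 0, 1) t).2.2)) ≤ ε * n / 4 := by
      have : √((1 + n) * (1 / (digitPath digitStep n (0, 0, 1) t).2.2)) ≤ ε * n / (8 * c) := by
        refine Real.sqrt_le_iff.2 ⟨by positivity, ?_⟩
        calc (1 + n) * (1 / (digitPath digitStep n (0, 0, 1) t).2.2) ≤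
            (2 * n) * (ε ^ 2 * n / (128 * c ^ 2)) := mul_le_mul (by linarith) g3.le
              (zero_le_one.trans (one_le_one_div_of_mem hadm.1)) (by positivity)
          _ = _ := by field_simp; norm_num
      calc _ ≤ 2 * c * (ε * n / (8 * c)) := by gcongr
        _ = _ := by field_simp; norm_num
    have k4 : (2 * C + c) * Real.log (1 + n) < ε * n / 4 := by
      rw [div_lt_iff₀ (by linarith)] at hn1
      linarith
    linarith
  · congr 1
    field_simp
    ring
  · congr 1
    field_simp
  · congr 1
    rw [one_mul]
    field_simp

theorem digitPath_succ {α : Type*} (step : α → ℕ → α) (n : ℕ) (a : α) (t : ℝ) :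
    digitPath step (n + 1) a t = step (digitPath step n a t) (excess (negT^[n] t)) := by
  induction n generalizing a t with
  | zero => rfl
  | succ n ih => exact ih (step a (excess t)) (negT t)

theorem irrational_negT {t : ℝ} (ht : Irrational t) :
    Irrational (negT t) ∧ negT t ∈ Set.Ioo (0 : ℝ) 1 := by
  have h : Irrational (negT t) := by
    unfold negT Int.fract
    rw [neg_div, one_div]
    exact (irrational_sub_intCast_iff).2 (irrational_neg_iff.2 (irrational_inv_iff.2 ht))
  exact ⟨h, lt_of_le_of_ne (Int.fract_nonneg _) h.ne_zero.symm, Int.fract_lt_one _⟩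

theorem irrational_negT_iterate {t : ℝ} (ht : Irrational t) (h : t ∈ Set.Ioo (0 : ℝ) 1) (n : ℕ) :
    Irrational (negT^[n] t) ∧ negT^[n] t ∈ Set.Ioo (0 : ℝ) 1 := by
  induction n with
  | zero => exact ⟨ht, h⟩
  | succ n ih => rw [Function.iterate_succ_apply']; exact irrational_negT ih.1

theorem ceil_one_div_toNat {t : ℝ} (h : t ∈ Set.Ioo (0 : ℝ) 1) :
    ⌈1 / t⌉.toNat = excess t + 2 ∧ t * (excess t + 2 - negT t) = 1 := by
  have h1 : 1 < 1 / t := (one_lt_div h.1).2 h.2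
  have h2 : 1 < ⌈1 / t⌉ := Int.lt_ceil.2 (by exact_mod_cast h1)
  have h3 : ⌈1 / t⌉.toNat = excess t + 2 := by unfold excess; omega
  refine ⟨h3, ?_⟩
  have h4 : ((excess t : ℝ) + 2) = ⌈1 / t⌉ := by
    have : ((⌈1 / t⌉.toNat : ℤ) : ℝ) = ⌈1 / t⌉ := by rw [Int.toNat_of_nonneg (by omega)]
    rw [← this, h3]; push_cast; rfl
  have h5 : negT t = ⌈1 / t⌉ - 1 / t := by
    unfold negT Int.fract
    rw [neg_div, Int.floor_neg]
    push_cast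
    ring
  rw [h4, h5, sub_sub_cancel, mul_one_div_cancel h.1.ne']

theorem negQ_invariants {x : ℝ} (hx : Irrational x) (hx1 : x ∈ Set.Ioo (0 : ℝ) 1) (n : ℕ) :
    (0 : ℝ) < negQ x (n + 1) ∧
    (digitPath digitStep n (0, 0, 1) (1 - x)).1 = Real.log (negQ x (n + 1)) ∧
    negQ x (n + 1) * (1 - (digitPath digitStep n (0, 0, 1) (1 - x)).2.2) = negQ x n ∧
    x * (negQ x (n + 1) - negT^[n] (1 - x) * negQ x n) =
      negP x (n + 1) - negT^[n] (1 - x) * negP x n ∧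
    negP x (n + 1) * negQ x n - negP x n * negQ x (n + 1) = -1 := by
  have hirr : Irrational (1 - x) := by
    have := irrational_intCast_sub_iff (m := 1).2 hx
    simpa using this
  induction n with
  | zero => simp [digitPath, negQ, negP]
  | succ n ih =>
    obtain ⟨h1, h2, h3, h4, h5⟩ := ih
    have hadm := (admissible_start (n := n) le_rfl).digitPath (1 - x)
    have hs := (irrational_negT_iterate hirr ⟨by linarith [hx1.2], by linarith [hx1.1]⟩ n).2
    obtain ⟨hc1, hc2⟩ := ceil_one_div_toNat hs
    rw [digitPath_succ, Function.iterate_succ_apply']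
    have hd : negDigit x (n + 1) = excess (negT^[n] (1 - x)) + 2 := hc1
    have hQ : negQ x (n + 1 + 1) = negDigit x (n + 1) * negQ x (n + 1) - negQ x n := rfl
    have hP : negP x (n + 1 + 1) = negDigit x (n + 1) * negP x (n + 1) - negP x n := rfl
    rw [hQ, hP, hd]
    generalize digitPath digitStep n (0, 0, 1) (1 - x) = a at *
    generalize negT^[n] (1 - x) = s at *
    generalize negT s = s' at *
    have hτ := hadm.1.1
    push_cast
    have hQ' : ((excess s : ℝ) + 2) * negQ x (n + 1) - negQ x n =
        negQ x (n + 1) * (excess s + 1 + a.2.2) := by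
      rw [← h3]; ring
    have hpos : (0 : ℝ) < excess s + 1 + a.2.2 := by positivity
    refine ⟨?_, ?_, ?_, ?_, ?_⟩
    · rw [hQ']; positivity
    · rw [hQ', Real.log_mul h1.ne' hpos.ne', ← h2]
      rfl
    · rw [hQ']
      simp only [digitStep]
      field_simp
      ring
    · refine mul_left_cancel₀ hs.1.ne' ?_
      linear_combination h4 + (x * negQ x (n + 1) - negP x (n + 1)) * hc2
    · linear_combination h5

theorem neg_log_abs_sub_convergent_mem {x : ℝ} (hx : Irrational x) (hx1 : x ∈ Set.Ioo (0 : ℝ) 1)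
    (n : ℕ) :
    2 * (digitPath digitStep n (0, 0, 1) (1 - x)).1 - Real.log (1 + n) ≤
      -Real.log |x - (negP x (n + 1) : ℝ) / (negQ x (n + 1) : ℝ)| ∧
    -Real.log |x - (negP x (n + 1) : ℝ) / (negQ x (n + 1) : ℝ)| ≤
      Real.log 2 + (digitPath digitStep n (0, 0, 1) (1 - x)).1 +
        (digitPath digitStep (n + 1) (0, 0, 1) (1 - x)).1 := by
  have hirr : Irrational (1 - x) := by
    have := irrational_intCast_sub_iff (m := 1).2 hx
    simpa using this
  obtain ⟨h1, h2, h3, h4, h5⟩ := negQ_invariants hx hx1 n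
  have hadm := (admissible_start (n := n) le_rfl).digitPath (1 - x)
  have hs := (irrational_negT_iterate hirr ⟨by linarith [hx1.2], by linarith [hx1.1]⟩ n).2
  obtain ⟨-, hc2⟩ := ceil_one_div_toNat hs
  have hs' := (irrational_negT (irrational_negT_iterate hirr
    ⟨by linarith [hx1.2], by linarith [hx1.1]⟩ n).1).2
  rw [digitPath_succ]
  generalize digitPath digitStep n (0, 0, 1) (1 - x) = a at *
  generalize negT^[n] (1 - x) = s at *
  have hτ := hadm.1
  have hτn : 1 / a.2.2 ≤ 1 + n := by simpa using hadm.2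
  have h5r : (negP x (n + 1) : ℝ) * negQ x n - negP x n * negQ x (n + 1) = -1 := by
    exact_mod_cast h5
  set Q : ℝ := (negQ x (n + 1) : ℝ)
  have hden : a.2.2 ≤ 1 - s * (1 - a.2.2) := by nlinarith [hs.2, hs.1, hτ.1, hτ.2]
  have hden1 : 1 - s * (1 - a.2.2) ≤ 1 := by nlinarith [hs.1, hτ.2]
  have hden0 : 0 < 1 - s * (1 - a.2.2) := hτ.1.trans_le hden
  have herr : x - (negP x (n + 1) : ℝ) / Q = -(s / (Q ^ 2 * (1 - s * (1 - a.2.2)))) := by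
    have h4' : x * (Q - s * (Q * (1 - a.2.2))) = negP x (n + 1) - s * negP x n := by
      rw [h3]; exact h4
    have h5' : negP x (n + 1) * (Q * (1 - a.2.2)) - negP x n * Q = -1 := by
      rw [h3]; exact h5r
    field_simp
    linear_combination Q * h4' + s * h5'
  have hlog : -Real.log |x - (negP x (n + 1) : ℝ) / Q| =
      2 * a.1 + Real.log (1 - s * (1 - a.2.2)) - Real.log s := by
    rw [herr, abs_neg, abs_of_pos (div_pos hs.1 (by positivity)),
      Real.log_div hs.1.ne' (by positivity), Real.log_mul (by positivity) hden0.ne', Real.log_pow, h2]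
    push_cast
    ring
  rw [hlog]
  have l1 : Real.log s ≤ 0 := Real.log_nonpos hs.1.le hs.2.le
  have l2 : Real.log a.2.2 ≤ Real.log (1 - s * (1 - a.2.2)) := Real.log_le_log hτ.1 hden
  have l3 : Real.log (1 - s * (1 - a.2.2)) ≤ 0 := Real.log_nonpos hden0.le hden1
  have l4 : -Real.log a.2.2 ≤ Real.log (1 + n) := by
    rw [← Real.log_inv, ← one_div]
    exact Real.log_le_log (one_div_pos.2 hτ.1) hτn
  have hpos : (0 : ℝ) < excess s + 1 + a.2.2 := by have := hτ.1; positivity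
  have l5 : -Real.log s ≤ Real.log 2 + Real.log (excess s + 1 + a.2.2) := by
    rw [← Real.log_inv, ← Real.log_mul two_ne_zero hpos.ne']
    refine Real.log_le_log (inv_pos.2 hs.1) ?_
    rw [inv_eq_of_mul_eq_one_right hc2]
    have : (0 : ℝ) ≤ excess s := Nat.cast_nonneg _
    linarith [hs'.1, hτ.1]
  simp only [digitStep]
  constructor <;> linarith

theorem rate_of_logQ {n : ℕ} (hn : 1 ≤ n) {ε c X X' E : ℝ} (hε : 0 < ε) (hc : 0 ≤ c) (hX : 0 ≤ X)
    (hX' : 0 ≤ X') (hl : 1 ≤ Real.log (1 + n))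
    (hbig : Real.log (1 + n) ^ 2 + 2 * (c + ε / 8) ≤ ε / 2 * n)
    (h : |Real.log (1 + n) * X - c * n| ≤ ε / 8 * n)
    (h' : |Real.log (1 + (n + 1 : ℕ)) * X' - c * (n + 1 : ℕ)| ≤ ε / 8 * (n + 1 : ℕ))
    (hE : 2 * X - Real.log (1 + n) ≤ -E) (hE' : -E ≤ Real.log 2 + X + X') :
    |Real.log n / n * E + 2 * c| ≤ ε := by
  have hn0 : (1 : ℝ) ≤ n := by exact_mod_cast hn
  obtain ⟨g1, g2⟩ := _root_.abs_le.1 h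
  obtain ⟨-, g4⟩ := _root_.abs_le.1 h'
  push_cast at g4
  have a0 : 0 ≤ Real.log n := Real.log_nonneg hn0
  have a1 : Real.log n ≤ Real.log (1 + n) := Real.log_le_log (by linarith) (by linarith)
  have a2 : Real.log n ≤ Real.log (1 + (n + 1)) := Real.log_le_log (by linarith) (by linarith)
  have a3 : (Real.log (1 + n) - Real.log n) * n ≤ 1 := by
    rw [← Real.log_div (by linarith) (by linarith)]
    have := Real.log_le_sub_one_of_pos (show 0 < (1 + (n : ℝ)) / n by positivity)
    rw [show (1 + (n : ℝ)) / n - 1 = 1 / n by field_simp; ring, le_div_iff₀ (by linarith)] at this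
    exact this
  have a4 : Real.log 2 ≤ 1 := by
    linarith [Real.log_le_sub_one_of_pos (show (0 : ℝ) < 2 by norm_num)]
  have e1 : Real.log n * X ≤ Real.log (1 + n) * X := mul_le_mul_of_nonneg_right a1 hX
  have e2 : Real.log n * X' ≤ Real.log (1 + (n + 1)) * X' := mul_le_mul_of_nonneg_right a2 hX'
  have e3 : Real.log n * Real.log 2 ≤ Real.log (1 + n) ^ 2 := by
    nlinarith
  have e4 : Real.log n * Real.log (1 + n) ≤ Real.log (1 + n) ^ 2 := by nlinarith
  have e5 : (Real.log (1 + n) - Real.log n) * X ≤ c + ε / 8 := by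
    have hXn : X ≤ (c + ε / 8) * n := by nlinarith
    calc _ ≤ (Real.log (1 + n) - Real.log n) * ((c + ε / 8) * n) :=
          mul_le_mul_of_nonneg_left hXn (by linarith)
      _ = (c + ε / 8) * ((Real.log (1 + n) - Real.log n) * n) := by ring
      _ ≤ (c + ε / 8) * 1 := mul_le_mul_of_nonneg_left a3 (by positivity)
      _ = _ := mul_one _
  have f1 := mul_le_mul_of_nonneg_left hE a0
  have f2 := mul_le_mul_of_nonneg_left hE' a0
  have key : Real.log n / n * E + 2 * c = (2 * c * n - Real.log n * -E) / n := by
    field_simp; ring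
  rw [key, abs_div, abs_of_pos (show (0 : ℝ) < n by linarith), div_le_iff₀ (by linarith),
    _root_.abs_le]
  constructor <;> nlinarith

/-- `(log n / n) · log |x - Pₙ/Qₙ| → -π²/3` in measure.
(Recall `negP x (n+1) = Pₙ`, `negQ x (n+1) = Qₙ`.) -/
theorem negCF_approx_rate_in_measure :
    ∀ ε > (0 : ℝ), Tendsto
      (fun n : ℕ => volume {x : ℝ | x ∈ Set.Ioo (0 : ℝ) 1 ∧ Irrational x ∧
        |Real.log n / n * Real.log |x - (negP x (n + 1) : ℝ) / (negQ x (n + 1) : ℝ)| +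
          Real.pi ^ 2 / 3| > ε})
      atTop (nhds 0) := by
  intro ε hε
  let B : ℕ → Set ℝ := fun n => {t : ℝ | t ∈ Set.Ioo (0 : ℝ) 1 ∧ ε / 8 * n <
    |Real.log (1 + n) * (digitPath digitStep n (0, 0, 1) t).1 - Real.pi ^ 2 / 6 * n|}
  have h : Tendsto (fun n => volume (B n)) atTop (nhds 0) :=
    tendsto_volume_logQ (show 0 < ε / 8 by positivity)
  have hsum := h.add ((tendsto_add_atTop_iff_nat 1).2 h)
  rw [add_zero] at hsum
  refine tendsto_of_tendsto_of_tendsto_of_le_of_le' tendsto_const_nhds hsum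
    (Eventually.of_forall fun _ => bot_le) ?_
  have hbig : ∀ᶠ n : ℕ in atTop, Real.log (1 + n) ^ 2 + 2 * (Real.pi ^ 2 / 6 + ε / 8) ≤ ε / 2 * n := by
    have h1 := (((tendsto_log_pow_div_one_add 2).mul tendsto_one_add_natCast_div).add
      (tendsto_const_div_atTop_nhds_zero_nat (2 * (Real.pi ^ 2 / 6 + ε / 8))))
    simp only [zero_mul, add_zero] at h1
    filter_upwards [h1.eventually_lt_const (show 0 < ε / 2 by positivity),
      eventually_gt_atTop 0] with n hn hn1
    have hn0 : (0 : ℝ) < n := by exact_mod_cast hn1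
    rw [← div_le_iff₀ hn0]
    refine le_of_eq_of_le ?_ hn.le
    field_simp
  filter_upwards [hbig, eventually_ge_atTop 1, tendsto_log_one_add_natCast.eventually_ge_atTop 1]
    with n hn1 hn2 hn3
  have hpre : ∀ s : Set ℝ, volume ((fun x : ℝ => 1 - x) ⁻¹' s) = volume s := fun s =>
    (Measure.measurePreserving_sub_left volume (1 : ℝ)).measure_preimage_emb
      (MeasurableEquiv.subLeft (1 : ℝ)).measurableEmbedding s
  rw [← hpre (B n), ← hpre (B (n + 1))]
  refine (measure_mono ?_).trans (measure_union_le _ _)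
  rintro x ⟨hx1, hx, hbad⟩
  by_contra hcon
  have ht : 1 - x ∈ Set.Ioo (0 : ℝ) 1 := ⟨by linarith [hx1.2], by linarith [hx1.1]⟩
  simp only [B, Set.mem_union, Set.mem_preimage, Set.mem_ofPred_eq, ht, true_and, not_or, not_lt]
    at hcon
  have hnn : ∀ m, 0 ≤ (digitPath digitStep m (0, 0, 1) (1 - x)).1 := fun m => by
    obtain ⟨h1, h2, -⟩ := negQ_invariants hx hx1 m
    rw [h2]
    refine Real.log_nonneg ?_
    exact_mod_cast (Int.cast_pos.1 h1 : 0 < negQ x (m + 1))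
  have hmem := neg_log_abs_sub_convergent_mem hx hx1 n
  have := rate_of_logQ hn2 hε (by positivity) (hnn n) (hnn (n + 1)) hn3 hn1 hcon.1 hcon.2
    hmem.1 hmem.2
  rw [show 2 * (Real.pi ^ 2 / 6) = Real.pi ^ 2 / 3 by ring] at this
  exact absurd hbad (not_lt.2 this)
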